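/- arXiv:1206.0913 — 4 statements merged into one kernel-verified Lean document; each statement's English description precedes it below -/
import Mathlib

section
/- Let the semitopological semigroup G be represented on the complex Banach space X by a bounded semigroup 𝒮 = {S_g : g ∈ G}. Then there exists a weak right 𝒮-ergodic net in L(X) if and only if there exists a strong right 𝒮-ergodic net in L(X); likewise, there exists a weak 𝒮-ergodic net if and only if there exists a strong 𝒮-ergodic net. -/
open Filter Topology

noncomputable section

variable {G X : Type}

/-- The strong operator topology on `X →L[ℂ] X`: the topology induced by the
inclusion into the product `X → X` (pointwise norm convergence). -/
def sot (X : Type) [NormedAddCommGroup X] [NormedSpace ℂ X] :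
    TopologicalSpace (X →L[ℂ] X) :=
  TopologicalSpace.induced (fun T : X →L[ℂ] X => (T : X → X)) inferInstance

section
variable [NormedAddCommGroup X] [NormedSpace ℂ X]

/-- The closure, in the strong operator topology, of the convex hull of a set of operators;
this is `co̅ M`. -/
def sotClosedConvexHull (M : Set (X →L[ℂ] X)) : Set (X →L[ℂ] X) :=
  @closure _ (sot X) (convexHull ℝ M)

/-- A strong right `𝒮`-ergodic net: a net of operators in `co̅ 𝒮` which is strongly right
asymptotically invariant. -/
def StrongRightErgodicNet {ι : Type} [Preorder ι]
    (S : G → (X →L[ℂ] X)) (A : ι → (X →L[ℂ] X)) : Prop :=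
  (∀ α, A α ∈ sotClosedConvexHull (Set.range S)) ∧
  ∀ (x : X) (g : G),
    Tendsto (fun α => ‖A α x - A α (S g x)‖) atTop (nhds 0)

/-- A strong left `𝒮`-ergodic net. -/
def StrongLeftErgodicNet {ι : Type} [Preorder ι]
    (S : G → (X →L[ℂ] X)) (A : ι → (X →L[ℂ] X)) : Prop :=
  (∀ α, A α ∈ sotClosedConvexHull (Set.range S)) ∧
  ∀ (x : X) (g : G),
    Tendsto (fun α => ‖A α x - S g (A α x)‖) atTop (nhds 0)

/-- A strong `𝒮`-ergodic net: both a strong right and a strong left `𝒮`-ergodic net. -/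
def StrongErgodicNet {ι : Type} [Preorder ι]
    (S : G → (X →L[ℂ] X)) (A : ι → (X →L[ℂ] X)) : Prop :=
  StrongRightErgodicNet S A ∧ StrongLeftErgodicNet S A

/-- A weak right `𝒮`-ergodic net: a net of operators in `co̅ 𝒮` which is weakly right
asymptotically invariant (invariance in the weak topology `σ(X,X')`). -/
def WeakRightErgodicNet {ι : Type} [Preorder ι]
    (S : G → (X →L[ℂ] X)) (A : ι → (X →L[ℂ] X)) : Prop :=
  (∀ α, A α ∈ sotClosedConvexHull (Set.range S)) ∧
  ∀ (x : X) (g : G) (φ : X →L[ℂ] ℂ),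
    Tendsto (fun α => φ (A α x - A α (S g x))) atTop (nhds 0)

/-- A weak left `𝒮`-ergodic net. -/
def WeakLeftErgodicNet {ι : Type} [Preorder ι]
    (S : G → (X →L[ℂ] X)) (A : ι → (X →L[ℂ] X)) : Prop :=
  (∀ α, A α ∈ sotClosedConvexHull (Set.range S)) ∧
  ∀ (x : X) (g : G) (φ : X →L[ℂ] ℂ),
    Tendsto (fun α => φ (A α x - S g (A α x))) atTop (nhds 0)

/-- A weak `𝒮`-ergodic net: both a weak right and a weak left `𝒮`-ergodic net. -/
def WeakErgodicNet {ι : Type} [Preorder ι]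
    (S : G → (X →L[ℂ] X)) (A : ι → (X →L[ℂ] X)) : Prop :=
  WeakRightErgodicNet S A ∧ WeakLeftErgodicNet S A

end

lemma convex_sotClosedConvexHull {X : Type} [NormedAddCommGroup X] [NormedSpace ℂ X]
    (M : Set (X →L[ℂ] X)) : Convex ℝ (sotClosedConvexHull M) := by
  let L : (X →L[ℂ] X) →ₗ[ℝ] (X → X) :=
    { toFun := fun T => (T : X → X)
      map_add' := fun _ _ => rfl
      map_smul' := fun _ _ => rfl }
  have h : sotClosedConvexHull M = L ⁻¹' closure (L '' convexHull ℝ M) := by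
    ext T
    unfold sotClosedConvexHull sot
    rw [closure_induced]
    rfl
  rw [h]
  exact (((convex_convexHull ℝ M).linear_image L).closure).linear_preimage L

/-- Finite Mazur-type argument. -/
lemma exists_small {X V K : Type} [NormedAddCommGroup X] [NormedSpace ℂ X]
    [AddCommGroup V] [Module ℝ V] (C : Set V) (hC : Convex ℝ C)
    (L : K → V →ₗ[ℝ] X) {ι : Type} [Preorder ι] [Nonempty ι] [IsDirected ι (· ≤ ·)]
    (A : ι → V) (hA : ∀ a, A a ∈ C)
    (hlim : ∀ (k : K) (φ : X →L[ℂ] ℂ), Tendsto (fun a => φ (L k (A a))) atTop (𝓝 0))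
    (F : Finset K) (ε : ℝ) (hε : 0 < ε) : ∃ T ∈ C, ∀ k ∈ F, ‖L k T‖ < ε := by
  classical
  let Φ : V →ₗ[ℝ] (F → X) := LinearMap.pi fun k => L k
  have h0 : (0 : F → X) ∈ closure (Φ '' C) := by
    by_contra hn
    obtain ⟨f, u, hu0, hu⟩ := geometric_hahn_banach_point_closed
      (hC.linear_image Φ).closure isClosed_closure hn
    rw [map_zero] at hu0
    have hdec : ∀ y : F → X, f y = ∑ k, f (Pi.single k (y k)) := by
      intro y
      rw [← map_sum, Finset.univ_sum_single]
    have hk : ∀ k : F, Tendsto (fun a => f (Pi.single k (L k (A a)))) atTop (𝓝 0) := by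
      intro k
      let ψ : StrongDual ℝ X := f.comp (ContinuousLinearMap.single ℝ (fun _ : F => X) k)
      let φ : StrongDual ℂ X := StrongDual.extendRCLike ψ
      have := (Complex.continuous_re.tendsto 0).comp (hlim k φ)
      refine this.congr fun a => ?_
      exact StrongDual.re_extendRCLike_apply (𝕜 := ℂ) ψ (L k (A a))
    have hs : Tendsto (fun a => f (Φ (A a))) atTop (𝓝 0) := by
      have := tendsto_finset_sum Finset.univ (fun k _ => hk k)
      rw [Finset.sum_const_zero] at this
      refine this.congr fun a => ?_
      rw [hdec (Φ (A a))]
      rfl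
    have : u ≤ 0 := ge_of_tendsto hs
      (Eventually.of_forall fun a => (hu _ (subset_closure ⟨A a, hA a, rfl⟩)).le)
    linarith
  obtain ⟨_, ⟨T, hT, rfl⟩, hd⟩ := Metric.mem_closure_iff.1 h0 ε hε
  refine ⟨T, hT, fun k hk => ?_⟩
  rw [dist_zero_left] at hd
  exact lt_of_le_of_lt (norm_le_pi_norm (Φ T) ⟨k, hk⟩) hd

lemma exists_strong_net {X V K : Type} [NormedAddCommGroup X] [NormedSpace ℂ X]
    [AddCommGroup V] [Module ℝ V] (C : Set V) (hC : Convex ℝ C)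
    (L : K → V →ₗ[ℝ] X) {ι : Type} [Preorder ι] [Nonempty ι] [IsDirected ι (· ≤ ·)]
    (A : ι → V) (hA : ∀ a, A a ∈ C)
    (hlim : ∀ (k : K) (φ : X →L[ℂ] ℂ), Tendsto (fun a => φ (L k (A a))) atTop (𝓝 0)) :
    ∃ B : Finset K × ℕ → V, (∀ b, B b ∈ C) ∧
      ∀ k, Tendsto (fun b => ‖L k (B b)‖) atTop (𝓝 0) := by
  classical
  have h := fun b : Finset K × ℕ => exists_small C hC L A hA hlim b.1 (1 / ((b.2 : ℝ) + 1))
    Nat.one_div_pos_of_nat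
  choose B hB hs using h
  refine ⟨B, hB, fun k => ?_⟩
  have ht : Tendsto (fun b : Finset K × ℕ => 1 / ((b.2 : ℝ) + 1)) atTop (𝓝 0) := by
    rw [← prod_atTop_atTop_eq]
    exact (tendsto_one_div_add_atTop_nhds_zero_nat (𝕜 := ℝ)).comp tendsto_snd
  refine squeeze_zero' (Eventually.of_forall fun _ => norm_nonneg _) ?_ ht
  filter_upwards [eventually_ge_atTop (({k}, 0) : Finset K × ℕ)] with b hb
  exact (hs b k (hb.1 (Finset.mem_singleton_self k))).le

/-- The map `T ↦ T x - T (S x)`. -/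
def rightMap {X : Type} [NormedAddCommGroup X] [NormedSpace ℂ X]
    (S : X →L[ℂ] X) (x : X) : (X →L[ℂ] X) →ₗ[ℝ] X where
  toFun T := T x - T (S x)
  map_add' T U := by simp only [ContinuousLinearMap.add_apply]; abel
  map_smul' c T := by simp [smul_sub]

/-- The map `T ↦ T x - S (T x)`. -/
def leftMap {X : Type} [NormedAddCommGroup X] [NormedSpace ℂ X]
    (S : X →L[ℂ] X) (x : X) : (X →L[ℂ] X) →ₗ[ℝ] X where
  toFun T := T x - S (T x)
  map_add' T U := by simp only [ContinuousLinearMap.add_apply, map_add]; abel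
  map_smul' c T := by
    have : S (c • T x) = c • S (T x) := by
      rw [← Complex.coe_smul, map_smul, Complex.coe_smul]
    simp [smul_sub, this]

lemma tendsto_dual_of_norm {X ι : Type} [NormedAddCommGroup X] [NormedSpace ℂ X]
    {l : Filter ι} {f : ι → X} (h : Tendsto (fun a => ‖f a‖) l (𝓝 0)) (φ : X →L[ℂ] ℂ) :
    Tendsto (fun a => φ (f a)) l (𝓝 0) := by
  have := (φ.continuous.tendsto 0).comp (tendsto_zero_iff_norm_tendsto_zero.2 h)
  rwa [map_zero] at this

/-- Let the semitopological semigroup `G` be represented on the complex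
Banach space `X` by a bounded semigroup `𝒮 = {S_g : g ∈ G}`. Then there exists a weak
right `𝒮`-ergodic net iff there exists a strong right `𝒮`-ergodic net; likewise, there
exists a weak `𝒮`-ergodic net iff there exists a strong `𝒮`-ergodic net. -/
theorem exists_weak_iff_exists_strong_ergodic_net
    {G X : Type} [Semigroup G] [TopologicalSpace G]
    [NormedAddCommGroup X] [NormedSpace ℂ X] [CompleteSpace X]
    (S : G → (X →L[ℂ] X))
    (hGcont₁ : ∀ g : G, Continuous fun h : G => g * h)
    (hGcont₂ : ∀ g : G, Continuous fun h : G => h * g)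
    (hbdd : ∃ C : ℝ, ∀ g : G, ‖S g‖ ≤ C)
    (hmul : ∀ g h : G, (S g).comp (S h) = S (h * g))
    (hScont : ∀ x : X, Continuous fun g : G => S g x) :
    ((∃ (ι : Type) (_ : Preorder ι) (A : ι → (X →L[ℂ] X)),
        Nonempty ι ∧ IsDirected ι (· ≤ ·) ∧ WeakRightErgodicNet S A) ↔
      (∃ (ι : Type) (_ : Preorder ι) (A : ι → (X →L[ℂ] X)),
        Nonempty ι ∧ IsDirected ι (· ≤ ·) ∧ StrongRightErgodicNet S A)) ∧
    ((∃ (ι : Type) (_ : Preorder ι) (A : ι → (X →L[ℂ] X)),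
        Nonempty ι ∧ IsDirected ι (· ≤ ·) ∧ WeakErgodicNet S A) ↔
      (∃ (ι : Type) (_ : Preorder ι) (A : ι → (X →L[ℂ] X)),
        Nonempty ι ∧ IsDirected ι (· ≤ ·) ∧ StrongErgodicNet S A)) := by
  constructor
  · constructor
    · rintro ⟨ι, _, A, _, _, hA, hw⟩
      obtain ⟨B, hB, hs⟩ := exists_strong_net (K := X × G) _
        (convex_sotClosedConvexHull (Set.range S)) (fun k => rightMap (S k.2) k.1) A hA
        (fun k φ => hw k.1 k.2 φ)
      exact ⟨Finset (X × G) × ℕ, inferInstance, B, inferInstance,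
        by classical exact inferInstance, hB, fun x g => hs (x, g)⟩
    · rintro ⟨ι, _, A, hn, hd, hA, hs⟩
      exact ⟨ι, inferInstance, A, hn, hd, hA, fun x g => tendsto_dual_of_norm (hs x g)⟩
  · constructor
    · rintro ⟨ι, _, A, _, _, ⟨hA, hw⟩, -, hw'⟩
      obtain ⟨B, hB, hs⟩ := exists_strong_net (K := (X × G) ⊕ (X × G)) _
        (convex_sotClosedConvexHull (Set.range S))
        (Sum.elim (fun k => rightMap (S k.2) k.1) (fun k => leftMap (S k.2) k.1)) A hA
        (by
          rintro (k | k) φ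
          · exact hw k.1 k.2 φ
          · exact hw' k.1 k.2 φ)
      exact ⟨Finset ((X × G) ⊕ (X × G)) × ℕ, inferInstance, B, inferInstance,
        by classical exact inferInstance, ⟨hB, fun x g => hs (Sum.inl (x, g))⟩,
        hB, fun x g => hs (Sum.inr (x, g))⟩
    · rintro ⟨ι, _, A, hn, hd, ⟨hA, hs⟩, -, hs'⟩
      exact ⟨ι, inferInstance, A, hn, hd, ⟨hA, fun x g => tendsto_dual_of_norm (hs x g)⟩,
        hA, fun x g => tendsto_dual_of_norm (hs' x g)⟩
end
end

section
/- Let the semitopological semigroup G be represented on the complex Banach space X by a bounded amenable semigroup 𝒮 = {S_g : g ∈ G}. If 𝒮 is relatively compact with respect to the weak operator topology on L(X), then 𝒮 is mean ergodic. -/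
open Filter Topology

noncomputable section

variable {G X : Type}

section
variable [NormedAddCommGroup X] [NormedSpace ℂ X]

/-- `𝒮 = {S_g : g ∈ G}`, endowed with the strong operator topology and operator
multiplication (note `S_h S_g = S_{g h}`), is right amenable: there is a mean `m` on
`C_b(𝒮)` (a continuous linear functional with `⟨m, 1⟩ = ‖m‖ = 1`) which is right
invariant, i.e. `⟨m, R_T f⟩ = ⟨m, f⟩` for all `T ∈ 𝒮`, where `R_{S_g} f (S_h) = f (S_h S_g)
= f (S_{g h})`. -/
def RightAmenable [Mul G] (S : G → (X →L[ℂ] X)) : Prop :=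
  letI : TopologicalSpace (X →L[ℂ] X) := sot X
  ∃ m : BoundedContinuousFunction (Set.range S) ℂ →L[ℂ] ℂ,
    m (BoundedContinuousFunction.const _ (1 : ℂ)) = 1 ∧ ‖m‖ = 1 ∧
    ∀ (g : G) (f f' : BoundedContinuousFunction (Set.range S) ℂ),
      (∀ h : G, f' ⟨S h, ⟨h, rfl⟩⟩ = f ⟨S (g * h), ⟨g * h, rfl⟩⟩) → m f' = m f

/-- `𝒮 = {S_g : g ∈ G}`, endowed with the strong operator topology, is amenable: there is
a mean on `C_b(𝒮)` which is both right and left invariant (`L_{S_g} f (S_h) = f (S_g S_h)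
= f (S_{h g})`). -/
def Amenable [Mul G] (S : G → (X →L[ℂ] X)) : Prop :=
  letI : TopologicalSpace (X →L[ℂ] X) := sot X
  ∃ m : BoundedContinuousFunction (Set.range S) ℂ →L[ℂ] ℂ,
    m (BoundedContinuousFunction.const _ (1 : ℂ)) = 1 ∧ ‖m‖ = 1 ∧
    (∀ (g : G) (f f' : BoundedContinuousFunction (Set.range S) ℂ),
      (∀ h : G, f' ⟨S h, ⟨h, rfl⟩⟩ = f ⟨S (g * h), ⟨g * h, rfl⟩⟩) → m f' = m f) ∧
    (∀ (g : G) (f f' : BoundedContinuousFunction (Set.range S) ℂ),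
      (∀ h : G, f' ⟨S h, ⟨h, rfl⟩⟩ = f ⟨S (h * g), ⟨h * g, rfl⟩⟩) → m f' = m f)

/-- `P` is a zero element of `co̅ 𝒮`: `P ∈ co̅ 𝒮` and `P T = T P = P` for all
`T ∈ co̅ 𝒮`.  This is the mean ergodic projection of `𝒮`. -/
def IsMeanErgodicProjection (S : G → (X →L[ℂ] X)) (P : X →L[ℂ] X) : Prop :=
  P ∈ sotClosedConvexHull (Set.range S) ∧
  ∀ T ∈ sotClosedConvexHull (Set.range S), P.comp T = P ∧ T.comp P = P

/-- The semigroup `𝒮` is mean ergodic: `co̅ 𝒮` contains a zero element. -/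
def MeanErgodic (S : G → (X →L[ℂ] X)) : Prop :=
  ∃ P : X →L[ℂ] X, IsMeanErgodicProjection S P

/-- The fixed space `Fix 𝒮 = {x ∈ X : S_g x = x for all g}`, as a submodule of `X`. -/
def fixSpace (S : G → (X →L[ℂ] X)) : Submodule ℂ X where
  carrier := {x : X | ∀ g : G, S g x = x}
  add_mem' := fun hx hy g => by rw [map_add, hx g, hy g]
  zero_mem' := fun g => map_zero (S g)
  smul_mem' := fun c x hx g => by rw [map_smul, hx g]

/-- The closure of the linear span of `rg (I - 𝒮) = {x - S_g x : x ∈ X, g ∈ G}`. -/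
def errSpace (S : G → (X →L[ℂ] X)) : Submodule ℂ X :=
  (Submodule.span ℂ {y : X | ∃ (x : X) (g : G), y = x - S g x}).topologicalClosure

end

/-- The weak operator topology on `X →L[ℂ] X`. -/
def wot (X : Type) [NormedAddCommGroup X] [NormedSpace ℂ X] :
    TopologicalSpace (X →L[ℂ] X) :=
  TopologicalSpace.induced
    (fun T : X →L[ℂ] X => fun p : X × (X →L[ℂ] ℂ) => p.2 (T p.1)) inferInstance

section krein
open MeasureTheory

theorem aux_exists_dual {X : Type} [NormedAddCommGroup X] [NormedSpace ℂ X]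
    (Y : Submodule ℂ X) (hY : IsClosed (Y : Set X)) (b : X) (hb : b ∉ Y) :
    ∃ φ : X →L[ℂ] ℂ, (∀ y ∈ Y, φ y = 0) ∧ φ b ≠ 0 := by
  obtain ⟨f, u, h1, h2⟩ := RCLike.geometric_hahn_banach_closed_point (𝕜 := ℂ) (s := (Y : Set X))
    (x := b) (Y.restrictScalars ℝ).convex hY hb
  have h0 : 0 < u := by simpa using h1 0 Y.zero_mem
  have key : ∀ y ∈ Y, f y = 0 := by
    intro y hy
    by_contra hne
    have := h1 (((u : ℂ) / f y) • y) (Y.smul_mem _ hy)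
    rw [map_smul, smul_eq_mul, div_mul_cancel₀ _ hne] at this
    simp at this
  refine ⟨f, key, ?_⟩
  intro h
  rw [h] at h2
  simp at h2
  linarith

theorem aux_measurable {X K : Type} [NormedAddCommGroup X] [NormedSpace ℂ X]
    [TopologicalSpace K] [MeasurableSpace K] [BorelSpace K]
    (ι : K → X) (hι : ∀ φ : X →L[ℂ] ℂ, Continuous fun k => φ (ι k))
    (hsep : TopologicalSpace.IsSeparable (Set.range ι)) : StronglyMeasurable ι := by
  borelize X
  refine stronglyMeasurable_iff_measurable_separable.2 ⟨?_, hsep⟩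
  have hball : ∀ (d : X) (r : ℝ), 0 ≤ r → MeasurableSet (ι ⁻¹' Metric.closedBall d r) := by
    intro d r hr
    apply IsClosed.measurableSet
    have : ι ⁻¹' Metric.closedBall d r =
        ⋂ φ : {φ : X →L[ℂ] ℂ // ‖φ‖ ≤ 1}, {k | ‖φ.1 (ι k) - φ.1 d‖ ≤ r} := by
      ext k
      simp only [Set.mem_preimage, Metric.mem_closedBall, Set.mem_iInter, Set.mem_ofPred_eq,
        dist_eq_norm]
      constructor
      · intro h φ
        rw [← map_sub]
        refine (φ.1.le_opNorm _).trans ?_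
        have := φ.2
        nlinarith [norm_nonneg (ι k - d)]
      · intro h
        obtain ⟨g, hg, hg'⟩ := exists_dual_vector'' ℂ (ι k - d)
        have := h ⟨g, hg⟩
        rw [← map_sub] at this
        simp only at this
        rw [hg'] at this
        simpa using this
    rw [this]
    refine isClosed_iInter fun φ => isClosed_le ?_ continuous_const
    exact ((hι φ.1).sub continuous_const).norm
  obtain ⟨c, hc, hcl⟩ := hsep
  refine measurable_of_isOpen fun O hO => ?_
  have : ι ⁻¹' O = ⋃ d ∈ c, ⋃ n : ℕ, ⋃ (_ : Metric.closedBall d (1 / ((n : ℝ) + 1)) ⊆ O),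
      ι ⁻¹' Metric.closedBall d (1 / ((n : ℝ) + 1)) := by
    ext k
    simp only [Set.mem_preimage, Set.mem_iUnion, exists_prop]
    constructor
    · intro hk
      obtain ⟨ε, hε, hb⟩ := Metric.isOpen_iff.1 hO _ hk
      obtain ⟨n, hn⟩ := exists_nat_one_div_lt (half_pos hε)
      have hn0 : (0 : ℝ) < 1 / ((n : ℝ) + 1) := by positivity
      obtain ⟨d, hd, hdk⟩ := Metric.mem_closure_iff.1 (hcl ⟨k, rfl⟩) _ hn0
      refine ⟨d, hd, n, ?_, ?_⟩
      · intro y hy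
        apply hb
        rw [Metric.mem_closedBall] at hy
        rw [Metric.mem_ball]
        have := dist_triangle y d (ι k)
        rw [dist_comm d] at this
        linarith
      · rw [Metric.mem_closedBall]; exact hdk.le
    · rintro ⟨d, _, n, hs, hk⟩
      exact hs hk
  rw [this]
  refine MeasurableSet.biUnion hc fun d _ => MeasurableSet.iUnion fun n =>
    MeasurableSet.iUnion fun _ => hball _ _ (by positivity)

theorem aux_krein_sep {X K : Type} [NormedAddCommGroup X] [NormedSpace ℂ X] [CompleteSpace X]
    [TopologicalSpace K] [CompactSpace K] [T2Space K]
    (ι : K → X) (hι : ∀ φ : X →L[ℂ] ℂ, Continuous fun k => φ (ι k))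
    (C : ℝ) (hC : ∀ k, ‖ι k‖ ≤ C)
    (hsep : TopologicalSpace.IsSeparable (Set.range ι))
    (x : ℕ → X) (hx : ∀ n, x n ∈ convexHull ℝ (Set.range ι)) :
    ∃ b : X, ∀ φ : X →L[ℂ] ℂ, Tendsto (fun n => φ (x n)) (hyperfilter ℕ) (𝓝 (φ b)) := by
  borelize K
  have hsm := aux_measurable ι hι hsep
  have hint : ∀ μ : Measure K, IsFiniteMeasure μ → Integrable ι μ := fun μ _ =>
    Integrable.of_bound hsm.aestronglyMeasurable C (Eventually.of_forall hC)
  have hconv : Convex ℝ {b : X | ∃ μ : ProbabilityMeasure K, b = ∫ k, ι k ∂(μ : Measure K)} := by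
    rintro _ ⟨μ, rfl⟩ _ ⟨ν, rfl⟩ s t hs ht hst
    let ρ : Measure K := ENNReal.ofReal s • (μ : Measure K) + ENNReal.ofReal t • (ν : Measure K)
    have hρ : IsProbabilityMeasure ρ := by
      constructor
      simp only [ρ, Measure.add_apply, Measure.smul_apply, measure_univ, smul_eq_mul, mul_one]
      rw [← ENNReal.ofReal_add hs ht, hst, ENNReal.ofReal_one]
    refine ⟨⟨ρ, hρ⟩, ?_⟩
    simp only [ProbabilityMeasure.coe_mk, ρ]
    rw [integral_add_measure, integral_smul_measure, integral_smul_measure,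
      ENNReal.toReal_ofReal hs, ENNReal.toReal_ofReal ht]
    · exact (hint _ inferInstance).smul_measure ENNReal.ofReal_ne_top
    · exact (hint _ inferInstance).smul_measure ENNReal.ofReal_ne_top
  have hsub : convexHull ℝ (Set.range ι) ⊆
      {b : X | ∃ μ : ProbabilityMeasure K, b = ∫ k, ι k ∂(μ : Measure K)} := by
    refine convexHull_min ?_ hconv
    rintro _ ⟨k, rfl⟩
    exact ⟨⟨Measure.dirac k, inferInstance⟩, (integral_dirac' ι k hsm).symm⟩
  choose μ hμ using fun n => hsub (hx n)
  let U : Ultrafilter (ProbabilityMeasure K) := (hyperfilter ℕ).map μ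
  obtain ⟨ν, -, hν⟩ := (isCompact_univ (X := ProbabilityMeasure K)).ultrafilter_le_nhds U (by simp)
  have hten : Tendsto μ (hyperfilter ℕ) (𝓝 ν) := hν
  refine ⟨∫ k, ι k ∂(ν : Measure K), fun φ => ?_⟩
  have := (ProbabilityMeasure.tendsto_iff_forall_integral_rclike_tendsto ℂ).1 hten
    (BoundedContinuousFunction.mkOfCompact ⟨fun k => φ (ι k), hι φ⟩)
  simp only [BoundedContinuousFunction.mkOfCompact_apply, ContinuousMap.coe_mk] at this
  rw [φ.integral_comp_comm (hint _ inferInstance)] at this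
  refine this.congr fun n => ?_
  rw [hμ n]
  exact φ.integral_comp_comm (hint _ inferInstance)

theorem aux_krein_seq {X K : Type} [NormedAddCommGroup X] [NormedSpace ℂ X] [CompleteSpace X]
    [TopologicalSpace K] [CompactSpace K] [T2Space K]
    (ι : K → X) (hι : ∀ φ : X →L[ℂ] ℂ, Continuous fun k => φ (ι k))
    (x : ℕ → X) (hx : ∀ n, x n ∈ convexHull ℝ (Set.range ι)) :
    ∃ b : X, ∀ φ : X →L[ℂ] ℂ, Tendsto (fun n => φ (x n)) (hyperfilter ℕ) (𝓝 (φ b)) := by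
  obtain ⟨C, hC⟩ : ∃ C, ∀ k, ‖NormedSpace.inclusionInDoubleDual ℂ X (ι k)‖ ≤ C := by
    apply banach_steinhaus
    intro φ
    obtain ⟨C, hC⟩ := isCompact_univ.exists_bound_of_continuousOn (hι φ).continuousOn
    exact ⟨C, fun k => by simpa using hC k trivial⟩
  have hC' : ∀ k, ‖ι k‖ ≤ C := fun k => by
    have := hC k
    rwa [show ‖NormedSpace.inclusionInDoubleDual ℂ X (ι k)‖ = ‖ι k‖ from
      (NormedSpace.inclusionInDoubleDualLi ℂ).norm_map (ι k)] at this
  have h1 : ∀ n, ∃ t : Finset X, (t : Set X) ⊆ Set.range ι ∧ x n ∈ convexHull ℝ (t : Set X) := by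
    intro n
    have := hx n
    rw [convexHull_eq_union_convexHull_finite_subsets] at this
    simpa using this
  choose t ht hxt using h1
  let D : Set X := ⋃ n, (t n : Set X)
  have hD : D.Countable := Set.countable_iUnion fun n => (t n).countable_toSet
  let Y : Submodule ℂ X := (Submodule.span ℂ D).topologicalClosure
  have hYc : IsClosed (Y : Set X) := Submodule.isClosed_topologicalClosure _
  have hDY : D ⊆ Y := Submodule.subset_span.trans (Submodule.le_topologicalClosure _)
  have hYsep : TopologicalSpace.IsSeparable (Y : Set X) := by
    have : TopologicalSpace.IsSeparable (Submodule.span ℂ D : Set X) :=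
      hD.isSeparable.span (R := ℂ)
    exact this.closure
  let K' : Set K := {k | ι k ∈ Y}
  have hK' : IsClosed K' := by
    have : K' = ⋂ φ : {φ : X →L[ℂ] ℂ // ∀ y ∈ Y, φ y = 0}, {k | φ.1 (ι k) = 0} := by
      ext k
      simp only [K', Set.mem_ofPred_eq, Set.mem_iInter]
      constructor
      · intro h φ
        exact φ.2 _ h
      · intro h
        by_contra hk
        obtain ⟨φ, h1, h2⟩ := aux_exists_dual Y hYc _ hk
        exact h2 (h ⟨φ, h1⟩)
    rw [this]
    exact isClosed_iInter fun φ => isClosed_eq (hι φ.1) continuous_const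
  have : CompactSpace K' := isCompact_iff_compactSpace.1 hK'.isCompact
  refine aux_krein_sep (fun k : K' => ι k) (fun φ => (hι φ).comp continuous_subtype_val) C
    (fun k => hC' k) (hYsep.mono ?_) x (fun n => convexHull_mono ?_ (hxt n))
  · rintro _ ⟨k, rfl⟩
    exact k.2
  · intro y hy
    obtain ⟨k, rfl⟩ := ht n hy
    exact ⟨⟨k, hDY (Set.mem_iUnion.2 ⟨n, hy⟩)⟩, rfl⟩

theorem aux_norming {V : Type} [NormedAddCommGroup V] [NormedSpace ℂ V]
    (E : Submodule ℂ (V →L[ℂ] ℂ)) [FiniteDimensional ℂ E] :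
    ∃ N : Finset V, (∀ v ∈ N, ‖v‖ ≤ 1) ∧ ∀ F ∈ E, ∃ v ∈ N, ‖F‖ ≤ 2 * ‖F v‖ := by
  classical
  have : ProperSpace E := FiniteDimensional.proper ℂ E
  have hcomp : IsCompact (Metric.sphere (0 : E) 1) := isCompact_sphere _ _
  have hloc : ∀ F : E, F ∈ Metric.sphere (0 : E) 1 → ∃ v : V, ‖v‖ ≤ 1 ∧ 1 / 2 < ‖F.1 v‖ := by
    intro F hF
    have hF1 : ‖F.1‖ = 1 := by
      have h : dist F.1 0 = 1 := hF
      rwa [dist_zero_right] at h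
    obtain ⟨v, hv, hv'⟩ := F.1.exists_lt_apply_of_lt_opNorm (r := 1 / 2) (by rw [hF1]; norm_num)
    exact ⟨v, hv.le, hv'⟩
  obtain ⟨s, hs⟩ := hcomp.elim_finite_subcover
    (fun v : {v : V // ‖v‖ ≤ 1} => {F : E | 1 / 2 < ‖F.1 v.1‖})
    (fun v => isOpen_lt continuous_const (by fun_prop))
    (fun F hF => by
      obtain ⟨v, hv, hv'⟩ := hloc F hF
      exact Set.mem_iUnion.2 ⟨⟨v, hv⟩, hv'⟩)
  refine ⟨insert 0 (s.image Subtype.val), ?_, ?_⟩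
  · intro v hv
    rcases Finset.mem_insert.1 hv with rfl | hv
    · simp
    · obtain ⟨w, _, rfl⟩ := Finset.mem_image.1 hv
      exact w.2
  · intro F hF
    by_cases h0 : F = 0
    · exact ⟨0, by simp, by simp [h0]⟩
    have hn : 0 < ‖F‖ := norm_pos_iff.2 h0
    have hmem : (((‖F‖ : ℂ)⁻¹) • (⟨F, hF⟩ : E)) ∈ Metric.sphere (0 : E) 1 := by
      change dist (((‖F‖ : ℂ)⁻¹) • F) 0 = 1
      rw [dist_zero_right, norm_smul]
      simp [hn.ne']
    obtain ⟨v, hv, hv'⟩ := Set.mem_iUnion₂.1 (hs hmem)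
    refine ⟨v.1, Finset.mem_insert_of_mem (Finset.mem_image_of_mem _ hv), ?_⟩
    simp only [Set.mem_ofPred_eq, Submodule.coe_smul, smul_apply, norm_smul,
      norm_inv, Complex.norm_real, norm_norm] at hv'
    rw [inv_mul_eq_div, lt_div_iff₀ hn] at hv'
    linarith

theorem aux_norming' {V : Type} [NormedAddCommGroup V] [NormedSpace ℂ V]
    (B : Finset (V →L[ℂ] ℂ)) :
    ∃ N : Finset V, (∀ v ∈ N, ‖v‖ ≤ 1) ∧
      ∀ F ∈ Submodule.span ℂ (B : Set (V →L[ℂ] ℂ)), ∃ v ∈ N, ‖F‖ ≤ 2 * ‖F v‖ := by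
  have : FiniteDimensional ℂ (Submodule.span ℂ (B : Set (V →L[ℂ] ℂ))) :=
    FiniteDimensional.span_finset ℂ _
  exact aux_norming _

theorem aux_span_sub {X W : Type} [AddCommGroup X] [Module ℂ X] [AddCommGroup W] [Module ℂ W]
    [DecidableEq W] (w : W) (J : X →ₗ[ℂ] W) (s : Finset X) (v : X)
    (hv : v ∈ Submodule.span ℂ (s : Set X)) :
    w - J v ∈ Submodule.span ℂ ((insert w (s.image J) : Finset W) : Set W) := by
  refine Submodule.sub_mem _ (Submodule.subset_span (by simp)) ?_
  have : Submodule.span ℂ (s : Set X) ≤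
      (Submodule.span ℂ ((insert w (s.image J) : Finset W) : Set W)).comap J := by
    refine Submodule.span_le.2 fun y hy => ?_
    refine Submodule.subset_span ?_
    simp only [Finset.coe_insert, Finset.coe_image]
    exact Or.inr ⟨y, hy, rfl⟩
  exact this hv

theorem aux_whitley {X : Type} [NormedAddCommGroup X] [NormedSpace ℂ X]
    (Φ : (X →L[ℂ] ℂ) →L[ℂ] ℂ) (A : Set X)
    (hA : ∀ (N : Finset (X →L[ℂ] ℂ)) (ε : ℝ), 0 < ε → ∃ y ∈ A, ∀ φ ∈ N, ‖Φ φ - φ y‖ < ε)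
    (hseq : ∀ x : ℕ → X, (∀ n, x n ∈ A) →
      ∃ b : X, ∀ φ : X →L[ℂ] ℂ, Tendsto (fun n => φ (x n)) (hyperfilter ℕ) (𝓝 (φ b))) :
    ∃ b : X, ∀ φ, Φ φ = φ b := by
  classical
  let J : X →L[ℂ] ((X →L[ℂ] ℂ) →L[ℂ] ℂ) := NormedSpace.inclusionInDoubleDual ℂ X
  have hJ : ∀ x φ, J x φ = φ x := fun x φ => NormedSpace.dual_def ℂ X x φ
  have hJn : ∀ x, ‖J x‖ = ‖x‖ := fun x => (NormedSpace.inclusionInDoubleDualLi ℂ).norm_map x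
  have hN : ∀ s : Finset X, ∃ N : Finset (X →L[ℂ] ℂ), (∀ φ ∈ N, ‖φ‖ ≤ 1) ∧
      ∀ v ∈ Submodule.span ℂ (s : Set X), ∃ φ ∈ N, ‖Φ - J v‖ ≤ 2 * ‖Φ φ - φ v‖ := by
    intro s
    obtain ⟨N, h1, h2⟩ := aux_norming' (insert Φ (s.image J))
    refine ⟨N, h1, fun v hv => ?_⟩
    have hmem := aux_span_sub Φ (J : X →ₗ[ℂ] ((X →L[ℂ] ℂ) →L[ℂ] ℂ)) s v hv
    obtain ⟨φ, hφ, h⟩ := h2 _ hmem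
    exact ⟨φ, hφ, by simpa [hJ] using h⟩
  choose N hN1 hN2 using hN
  choose y hyA hy using fun (N : Finset (X →L[ℂ] ℂ)) (n : ℕ) =>
    hA N (1 / ((n : ℝ) + 1)) (by positivity)
  let N' : Finset X → Finset (X →L[ℂ] ℂ) := fun s => s.powerset.biUnion N
  obtain ⟨s, hs'⟩ : ∃ s : ℕ → Finset X, ∀ n, s (n + 1) = insert (y (N' (s n)) n) (s n) :=
    ⟨fun n => Nat.rec ∅ (fun n s => insert (y (N' s) n) s) n, fun n => rfl⟩
  let x : ℕ → X := fun n => y (N' (s n)) n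
  have hs : ∀ n, s (n + 1) = insert (x n) (s n) := hs'
  have hmono : Monotone s := monotone_nat_of_le_succ fun n => by
    rw [hs]; exact Finset.subset_insert _ _
  obtain ⟨b, hb⟩ := hseq x fun n => hyA _ _
  have hΦb : ∀ j, ∀ φ ∈ N (s j), Φ φ = φ b := by
    intro j φ hφ
    refine tendsto_nhds_unique (f := fun n => φ (x n)) (l := (hyperfilter ℕ : Filter ℕ)) ?_ (hb φ)
    refine Tendsto.mono_left ?_ Nat.hyperfilter_le_atTop
    rw [tendsto_iff_norm_sub_tendsto_zero]
    refine squeeze_zero' (Eventually.of_forall fun _ => norm_nonneg _) ?_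
      tendsto_one_div_add_atTop_nhds_zero_nat
    filter_upwards [eventually_ge_atTop j] with n hn
    rw [norm_sub_rev]
    refine (hy (N' (s n)) n φ ?_).le
    exact Finset.mem_biUnion.2 ⟨s j, Finset.mem_powerset.2 (hmono hn), hφ⟩
  let Y : Submodule ℂ X := (Submodule.span ℂ (Set.range x)).topologicalClosure
  have hbY : b ∈ Y := by
    by_contra hbY
    obtain ⟨φ, h1, h2⟩ := aux_exists_dual Y (Submodule.isClosed_topologicalClosure _) b hbY
    apply h2
    refine tendsto_nhds_unique (hb φ) ?_
    have : (fun n => φ (x n)) = fun _ => 0 := by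
      funext n
      exact h1 _ (Submodule.le_topologicalClosure _ (Submodule.subset_span ⟨n, rfl⟩))
    rw [this]
    exact tendsto_const_nhds
  have hspan : ∀ v ∈ Submodule.span ℂ (Set.range x),
      ∃ j : ℕ, v ∈ Submodule.span ℂ ((s j : Finset X) : Set X) := by
    intro v hv
    induction hv using Submodule.span_induction with
    | mem v hv =>
      obtain ⟨n, rfl⟩ := hv
      exact ⟨n + 1, Submodule.subset_span (by rw [hs]; simp)⟩
    | zero => exact ⟨0, Submodule.zero_mem _⟩
    | add u v _ _ hu hv =>
      obtain ⟨i, hi⟩ := hu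
      obtain ⟨j, hj⟩ := hv
      refine ⟨max i j, Submodule.add_mem _ ?_ ?_⟩
      · exact Submodule.span_mono (Finset.coe_subset.2 (hmono (le_max_left i j))) hi
      · exact Submodule.span_mono (Finset.coe_subset.2 (hmono (le_max_right i j))) hj
    | smul c v _ hv =>
      obtain ⟨j, hj⟩ := hv
      exact ⟨j, Submodule.smul_mem _ _ hj⟩
  have hfin : ‖Φ - J b‖ ≤ 0 := by
    refine le_of_forall_pos_le_add fun ε hε => ?_
    have hbc : b ∈ closure (Submodule.span ℂ (Set.range x) : Set X) := hbY
    obtain ⟨v, hv, hvb⟩ := Metric.mem_closure_iff.1 hbc (ε / 3) (by positivity)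
    obtain ⟨j, hj⟩ := hspan v hv
    obtain ⟨φ, hφ, h⟩ := hN2 (s j) v hj
    rw [hΦb j φ hφ, ← map_sub] at h
    have h1 : ‖φ (b - v)‖ ≤ ‖b - v‖ := by
      refine (φ.le_opNorm _).trans ?_
      have := hN1 _ _ hφ
      nlinarith [norm_nonneg (b - v)]
    have h2 : ‖Φ - J b‖ ≤ ‖Φ - J v‖ + ‖J (v - b)‖ := by
      have : Φ - J b = (Φ - J v) + J (v - b) := by rw [map_sub]; abel
      rw [this]
      exact norm_add_le (Φ - J v) (J (v - b))
    rw [hJn, norm_sub_rev v b] at h2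
    rw [dist_eq_norm] at hvb
    linarith
  refine ⟨b, fun φ => ?_⟩
  have h := (Φ - J b).le_opNorm φ
  have h3 : (Φ - J b) φ = Φ φ - φ b := by rw [← hJ]; rfl
  rw [h3] at h
  have h4 : ‖Φ φ - φ b‖ ≤ 0 := h.trans (mul_nonpos_of_nonpos_of_nonneg hfin (norm_nonneg _))
  exact sub_eq_zero.1 (norm_le_zero_iff.1 h4)
end krein

section means
open BoundedContinuousFunction

theorem aux_mean_re {Ω : Type} [TopologicalSpace Ω] (m : BoundedContinuousFunction Ω ℂ →L[ℂ] ℂ)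
    (hm1 : m (BoundedContinuousFunction.const _ (1 : ℂ)) = 1) (hm : ‖m‖ = 1)
    (f : BoundedContinuousFunction Ω ℂ) (u : ℝ) (hf : ∀ ω, (f ω).re ≤ u) : (m f).re ≤ u := by
  by_contra hlt
  push Not at hlt
  set δ := (m f).re - u with hδ
  have hδ0 : 0 < δ := by linarith
  set R := ‖f‖ with hR
  have hR0 : 0 ≤ R := norm_nonneg _
  -- shift by a large constant
  let t : ℝ := R + |u| + (R ^ 2 + 1) / δ
  have hq : 0 < (R ^ 2 + 1) / δ := by positivity
  have ht0 : 0 < t := by positivity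
  have hbound : ‖f + BoundedContinuousFunction.const Ω ((t - u : ℝ) : ℂ)‖ ≤
      Real.sqrt (t ^ 2 + R ^ 2) := by
    refine (BoundedContinuousFunction.norm_le (Real.sqrt_nonneg _)).2 fun ω => ?_
    have h1 : ‖f ω‖ ≤ R := f.norm_coe_le_norm ω
    have hre := (abs_le.1 ((Complex.abs_re_le_norm (f ω)).trans h1)).1
    have him := abs_le.1 ((Complex.abs_im_le_norm (f ω)).trans h1)
    rw [Complex.norm_eq_sqrt_sq_add_sq]
    apply Real.sqrt_le_sqrt
    simp only [BoundedContinuousFunction.coe_add, Pi.add_apply,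
      BoundedContinuousFunction.const_apply, Complex.add_re, Complex.add_im, Complex.ofReal_re,
      Complex.ofReal_im, add_zero]
    have h2 := hf ω
    have h3 : 0 ≤ (f ω).re + (t - u) := by
      have := le_abs_self u
      simp only [t]
      linarith
    have h4 : (f ω).re + (t - u) ≤ t := by linarith
    have h5 : ((f ω).re + (t - u)) ^ 2 ≤ t ^ 2 := pow_le_pow_left₀ h3 h4 2
    have h6 : (f ω).im ^ 2 ≤ R ^ 2 := sq_le_sq' him.1 him.2
    linarith
  have hval : m (f + BoundedContinuousFunction.const Ω ((t - u : ℝ) : ℂ)) =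
      m f + ((t - u : ℝ) : ℂ) := by
    have : BoundedContinuousFunction.const Ω ((t - u : ℝ) : ℂ) =
        ((t - u : ℝ) : ℂ) • BoundedContinuousFunction.const Ω (1 : ℂ) := by
      ext ω; simp
    rw [map_add, this, map_smul, hm1]
    simp
  have h7 : (m f).re + (t - u) ≤ Real.sqrt (t ^ 2 + R ^ 2) := by
    have h8 := m.le_opNorm (f + BoundedContinuousFunction.const Ω ((t - u : ℝ) : ℂ))
    rw [hm, one_mul, hval] at h8
    have h9 := Complex.re_le_norm (m f + ((t - u : ℝ) : ℂ))
    rw [Complex.add_re, Complex.ofReal_re] at h9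
    linarith
  have h10 : t + δ ≤ Real.sqrt (t ^ 2 + R ^ 2) := by linarith
  have h11 : (t + δ) ^ 2 ≤ t ^ 2 + R ^ 2 := (Real.le_sqrt' (by positivity)).1 h10
  have h12 : t * δ ≥ R ^ 2 + 1 := by
    have : t ≥ (R ^ 2 + 1) / δ := by
      simp only [t]
      have := abs_nonneg u
      linarith
    calc t * δ ≥ (R ^ 2 + 1) / δ * δ := mul_le_mul_of_nonneg_right this hδ0.le
      _ = R ^ 2 + 1 := by field_simp
  nlinarith

theorem aux_mean_closure {Ω V J : Type} [TopologicalSpace Ω] [Fintype J]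
    [NormedAddCommGroup V] [NormedSpace ℂ V]
    (m : BoundedContinuousFunction Ω ℂ →L[ℂ] ℂ)
    (hm1 : m (BoundedContinuousFunction.const _ (1 : ℂ)) = 1) (hm : ‖m‖ = 1)
    (u : Ω → J → V) (e : J → V)
    (h : ∀ (j : J) (φ : V →L[ℂ] ℂ), ∃ f : BoundedContinuousFunction Ω ℂ,
      (∀ ω, f ω = φ (u ω j)) ∧ m f = φ (e j)) :
    e ∈ closure (convexHull ℝ (Set.range u)) := by
  classical
  by_contra hne
  obtain ⟨g, a, h1, h2⟩ := RCLike.geometric_hahn_banach_closed_point (𝕜 := ℂ)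
    (s := closure (convexHull ℝ (Set.range u))) (x := e)
    (convex_convexHull ℝ _).closure isClosed_closure hne
  have hg : ∀ v : J → V, g v = ∑ j, (g.comp (ContinuousLinearMap.single ℂ (fun _ : J => V) j)) (v j) := by
    intro v
    conv_lhs => rw [← Finset.univ_sum_single v]
    rw [map_sum]
    rfl
  choose f hf1 hf2 using fun j => h j (g.comp (ContinuousLinearMap.single ℂ (fun _ : J => V) j))
  have h3 := aux_mean_re m hm1 hm (∑ j, f j) a (fun ω => by
    have h4 := h1 (u ω) (subset_closure (subset_convexHull ℝ _ ⟨ω, rfl⟩))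
    rw [hg] at h4
    rw [BoundedContinuousFunction.sum_apply, Finset.sum_congr rfl fun j _ => hf1 j ω]
    exact h4.le)
  rw [map_sum, Finset.sum_congr rfl fun j _ => hf2 j, ← hg] at h3
  exact absurd h2 (not_lt.2 h3)

end means

theorem aux_wot_seq {X : Type} [NormedAddCommGroup X] [NormedSpace ℂ X] [CompleteSpace X]
    (M : Set (X →L[ℂ] X)) (hcpt : @IsCompact _ (wot X) (@closure _ (wot X) M)) (z : X)
    (x : ℕ → X) (hx : ∀ n, x n ∈ convexHull ℝ ((fun T : X →L[ℂ] X => T z) '' M)) :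
    ∃ b : X, ∀ φ : X →L[ℂ] ℂ, Tendsto (fun n => φ (x n)) (hyperfilter ℕ) (𝓝 (φ b)) := by
  let K : Set (X →L[ℂ] X) := @closure _ (wot X) M
  letI tK : TopologicalSpace K := @instTopologicalSpaceSubtype _ _ (wot X)
  have hc : CompactSpace K := (@isCompact_iff_compactSpace _ (wot X) _).1 hcpt
  have hev : ∀ p : X × (X →L[ℂ] ℂ), Continuous fun k : K => p.2 (k.1 p.1) := by
    intro p
    have h1 : @Continuous _ _ (wot X) _
        (fun T : X →L[ℂ] X => fun p : X × (X →L[ℂ] ℂ) => p.2 (T p.1)) := continuous_induced_dom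
    have h2 : @Continuous K _ tK (wot X) Subtype.val := @continuous_subtype_val _ (wot X) _
    have h3 := @Continuous.comp _ _ _ tK (wot X) _ _ _ h1 h2
    exact (continuous_apply p).comp h3
  have ht2 : T2Space K := by
    refine T2Space.of_injective_continuous
      (f := fun k : K => fun p : X × (X →L[ℂ] ℂ) => p.2 (k.1 p.1)) ?_ (continuous_pi hev)
    intro S T h
    apply Subtype.ext
    ext y
    refine (SeparatingDual.eq_iff_forall_dual_eq (R := ℂ)).2 fun φ => ?_
    exact congrFun h (y, φ)
  refine aux_krein_seq (fun k : K => k.1 z) (fun φ => hev (z, φ)) x (fun n => ?_)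
  refine convexHull_mono ?_ (hx n)
  rintro _ ⟨T, hT, rfl⟩
  exact ⟨⟨T, @subset_closure _ (wot X) _ _ hT⟩, rfl⟩

theorem aux_sot_mem {X : Type} [NormedAddCommGroup X] [NormedSpace ℂ X]
    (M : Set (X →L[ℂ] X)) (P : X →L[ℂ] X)
    (h : ∀ I : Finset X, (fun j : I => P j) ∈
      closure (convexHull ℝ (Set.range fun T : M => fun j : I => T.1 j))) :
    P ∈ sotClosedConvexHull M := by
  unfold sotClosedConvexHull sot
  rw [closure_induced]
  rw [mem_closure_iff]
  intro O hO hPO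
  obtain ⟨I, u, hu, hsub⟩ := isOpen_pi_iff.1 hO _ hPO
  have hopen : IsOpen (Set.univ.pi fun j : I => u j) :=
    isOpen_set_pi Set.finite_univ fun j _ => (hu j j.2).1
  obtain ⟨v, hv, hv'⟩ := mem_closure_iff.1 (h I) _ hopen (fun j _ => (hu j j.2).2)
  let L : (X →L[ℂ] X) →ₗ[ℝ] (I → X) :=
    { toFun := fun T j => T j
      map_add' := fun _ _ => rfl
      map_smul' := fun _ _ => rfl }
  have hL : (Set.range fun T : M => fun j : I => T.1 j) = L '' M := by
    ext w
    constructor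
    · rintro ⟨T, rfl⟩
      exact ⟨T.1, T.2, rfl⟩
    · rintro ⟨T, hT, rfl⟩
      exact ⟨⟨T, hT⟩, rfl⟩
  rw [hL, ← L.image_convexHull] at hv'
  obtain ⟨T, hT, rfl⟩ := hv'
  exact ⟨T, hsub fun j hj => hv ⟨j, hj⟩ trivial, T, hT, rfl⟩

theorem aux_sot_closed {X : Type} [NormedAddCommGroup X] [NormedSpace ℂ X]
    (M : Set (X →L[ℂ] X)) (P : X →L[ℂ] X)
    (h : ∀ T ∈ M, P.comp T = P ∧ T.comp P = P) :
    ∀ T ∈ sotClosedConvexHull M, P.comp T = P ∧ T.comp P = P := by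
  let Z : Set (X →L[ℂ] X) := {T | P.comp T = P ∧ T.comp P = P}
  have hconv : Convex ℝ Z := by
    rintro T ⟨hT1, hT2⟩ T' ⟨hT1', hT2'⟩ a b _ _ hab
    constructor
    · ext y
      have h1 : P (T y) = P y := congrArg (fun F : X →L[ℂ] X => F y) hT1
      have h2 : P (T' y) = P y := congrArg (fun F : X →L[ℂ] X => F y) hT1'
      change P (a • T y + b • T' y) = P y
      rw [map_add, ContinuousLinearMap.map_smul_of_tower, ContinuousLinearMap.map_smul_of_tower,
        h1, h2, ← add_smul, hab, one_smul]
    · ext y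
      have h1 : T (P y) = P y := congrArg (fun F : X →L[ℂ] X => F y) hT2
      have h2 : T' (P y) = P y := congrArg (fun F : X →L[ℂ] X => F y) hT2'
      change a • T (P y) + b • T' (P y) = P y
      rw [h1, h2, ← add_smul, hab, one_smul]
  have hclosed : @IsClosed _ (sot X) Z := by
    have hZ : Z = (fun T : X →L[ℂ] X => (T : X → X)) ⁻¹'
        {f : X → X | ∀ y, P (f y) = P y ∧ f (P y) = P y} := by
      ext T
      constructor
      · rintro ⟨h1, h2⟩ y
        exact ⟨congrArg (fun F : X →L[ℂ] X => F y) h1, congrArg (fun F : X →L[ℂ] X => F y) h2⟩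
      · intro h
        exact ⟨ContinuousLinearMap.ext fun y => (h y).1, ContinuousLinearMap.ext fun y => (h y).2⟩
    rw [hZ]
    refine isClosed_induced_iff.2 ⟨_, ?_, rfl⟩
    have : {f : X → X | ∀ y, P (f y) = P y ∧ f (P y) = P y} =
        ⋂ y, ({f : X → X | P (f y) = P y} ∩ {f | f (P y) = P y}) := by
      ext f; simp
    rw [this]
    refine isClosed_iInter fun y => IsClosed.inter ?_ ?_
    · exact isClosed_eq (P.continuous.comp (continuous_apply y)) continuous_const
    · exact isClosed_eq (continuous_apply (P y)) continuous_const
  have hsub : sotClosedConvexHull M ⊆ Z :=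
    @closure_minimal _ (sot X) _ _ (convexHull_min h hconv) hclosed
  exact fun T hT => hsub hT

theorem aux_main {X : Type} [NormedAddCommGroup X] [NormedSpace ℂ X] [CompleteSpace X]
    (M : Set (X →L[ℂ] X)) [tM : TopologicalSpace M]
    (hcont : ∀ y : X, Continuous fun T : M => T.1 y)
    (C : ℝ) (hC : ∀ T ∈ M, ‖T‖ ≤ C)
    (m : BoundedContinuousFunction M ℂ →L[ℂ] ℂ)
    (hm1 : m (BoundedContinuousFunction.const _ (1 : ℂ)) = 1) (hm : ‖m‖ = 1)
    (hcpt : @IsCompact _ (wot X) (@closure _ (wot X) M)) :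
    ∃ P : X →L[ℂ] X, P ∈ sotClosedConvexHull M ∧
      ∀ (y : X) (φ : X →L[ℂ] ℂ) (f : BoundedContinuousFunction M ℂ),
        (∀ T : M, f T = φ (T.1 y)) → m f = φ (P y) := by
  let F : X → (X →L[ℂ] ℂ) → BoundedContinuousFunction M ℂ := fun y φ =>
    BoundedContinuousFunction.ofNormedAddCommGroup (fun T : M => φ (T.1 y))
      (φ.continuous.comp (hcont y)) (‖φ‖ * (C * ‖y‖)) (fun T => by
        refine (φ.le_opNorm _).trans (mul_le_mul_of_nonneg_left ?_ (norm_nonneg _))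
        exact (T.1.le_opNorm y).trans (mul_le_mul_of_nonneg_right (hC _ T.2) (norm_nonneg _)))
  have hF : ∀ y φ (T : M), F y φ T = φ (T.1 y) := fun _ _ _ => rfl
  have hne : Nonempty M := by
    by_contra hem
    rw [not_nonempty_iff] at hem
    have : BoundedContinuousFunction.const M (1 : ℂ) = 0 := by
      ext T; exact hem.elim T
    rw [this, map_zero] at hm1
    exact zero_ne_one hm1
  have hC0 : 0 ≤ C := (norm_nonneg _).trans (hC _ hne.some.2)
  have hFn : ∀ y φ, ‖m (F y φ)‖ ≤ C * ‖y‖ * ‖φ‖ := by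
    intro y φ
    have h1 := m.le_opNorm (F y φ)
    rw [hm, one_mul] at h1
    refine h1.trans ?_
    have h2 : ‖F y φ‖ ≤ ‖φ‖ * (C * ‖y‖) :=
      BoundedContinuousFunction.norm_ofNormedAddCommGroup_le _ (by positivity) _
    linarith
  have hex : ∀ y : X, ∃ b : X, ∀ φ : X →L[ℂ] ℂ, m (F y φ) = φ b := by
    intro y
    let Φ : (X →L[ℂ] ℂ) →L[ℂ] ℂ := LinearMap.mkContinuous
      { toFun := fun φ => m (F y φ)
        map_add' := fun φ ψ => by
          rw [← map_add]; congr 1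
        map_smul' := fun c φ => by
          rw [RingHom.id_apply, ← map_smul]; congr 1 } (C * ‖y‖) (hFn y)
    have hΦ : ∀ φ, Φ φ = m (F y φ) := fun _ => rfl
    refine aux_whitley Φ (convexHull ℝ ((fun T : X →L[ℂ] X => T y) '' M)) ?_
      (fun x hx => aux_wot_seq M hcpt y x hx)
    · intro N ε hε
      have h1 := aux_mean_closure m hm1 hm (fun (T : M) (φ : N) => φ.1 (T.1 y))
        (fun φ : N => Φ φ.1) (fun φ ψ => ⟨ψ 1 • F y φ.1, fun T => by
          change ψ 1 * φ.1 (T.1 y) = _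
          rw [mul_comm, ← smul_eq_mul, ← map_smul, smul_eq_mul, mul_one], by
          rw [map_smul, hΦ, smul_eq_mul, mul_comm, ← smul_eq_mul, ← map_smul, smul_eq_mul,
            mul_one]⟩)
      obtain ⟨v, hv, hv'⟩ := Metric.mem_closure_iff.1 h1 ε hε
      let L : X →ₗ[ℝ] (N → ℂ) :=
        { toFun := fun z φ => φ.1 z
          map_add' := fun a b => by funext φ; exact map_add φ.1 a b
          map_smul' := fun c a => by
            funext φ; exact ContinuousLinearMap.map_smul_of_tower φ.1 c a }
      have hL : (Set.range fun (T : M) (φ : N) => φ.1 (T.1 y)) =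
          L '' ((fun T : X →L[ℂ] X => T y) '' M) := by
        ext w
        constructor
        · rintro ⟨T, rfl⟩
          exact ⟨_, ⟨T.1, T.2, rfl⟩, rfl⟩
        · rintro ⟨_, ⟨T, hT, rfl⟩, rfl⟩
          exact ⟨⟨T, hT⟩, rfl⟩
      rw [hL, ← L.image_convexHull] at hv
      obtain ⟨z, hz, rfl⟩ := hv
      refine ⟨z, hz, fun φ hφ => ?_⟩
      have h2 := (dist_le_pi_dist (fun φ : N => Φ φ.1) (L z) ⟨φ, hφ⟩).trans_lt hv'
      rw [dist_eq_norm] at h2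
      exact h2
  choose p hp using hex
  have hsepd : ∀ a b : X, (∀ φ : X →L[ℂ] ℂ, φ a = φ b) → a = b := fun a b h =>
    (SeparatingDual.eq_iff_forall_dual_eq (R := ℂ)).2 h
  let P : X →L[ℂ] X := LinearMap.mkContinuous
    { toFun := p
      map_add' := fun a b => hsepd _ _ fun φ => by
        rw [map_add, ← hp, ← hp, ← hp, ← map_add]
        congr 1
        ext T
        change φ (T.1 (a + b)) = φ (T.1 a) + φ (T.1 b)
        rw [map_add, map_add]
      map_smul' := fun c a => hsepd _ _ fun φ => by
        rw [RingHom.id_apply, map_smul, ← hp, ← hp, ← map_smul]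
        congr 1
        ext T
        change φ (T.1 (c • a)) = c • φ (T.1 a)
        rw [map_smul, map_smul] } C (fun y => by
      refine NormedSpace.norm_le_dual_bound ℂ _ (by positivity) fun φ => ?_
      change ‖φ (p y)‖ ≤ _
      rw [← hp]
      exact hFn y φ)
  have hP : ∀ y φ, m (F y φ) = φ (P y) := hp
  refine ⟨P, ?_, ?_⟩
  · refine aux_sot_mem M P fun I => ?_
    exact aux_mean_closure m hm1 hm (fun (T : M) (j : I) => T.1 j) (fun j : I => P j)
      (fun j φ => ⟨F j φ, fun T => rfl, hP _ _⟩)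
  · intro y φ f hf
    rw [← hP]
    congr 1
    ext T
    exact hf T

/-- Corollary 1.9. Let the semitopological semigroup `G` be represented
on the complex Banach space `X` by a bounded amenable semigroup `𝒮 = {S_g : g ∈ G}`.
If `𝒮` is relatively compact in the weak operator topology, then `𝒮` is mean ergodic. -/
theorem meanErgodic_of_relatively_wot_compact
    {G X : Type} [Semigroup G] [TopologicalSpace G]
    [NormedAddCommGroup X] [NormedSpace ℂ X] [CompleteSpace X]
    (S : G → (X →L[ℂ] X))
    (hGcont₁ : ∀ g : G, Continuous fun h : G => g * h)
    (hGcont₂ : ∀ g : G, Continuous fun h : G => h * g)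
    (hbdd : ∃ C : ℝ, ∀ g : G, ‖S g‖ ≤ C)
    (hmul : ∀ g h : G, (S g).comp (S h) = S (h * g))
    (hScont : ∀ x : X, Continuous fun g : G => S g x)
    (hamen : Amenable S)
    (hcpt : @IsCompact _ (wot X) (@closure _ (wot X) (Set.range S))) :
    MeanErgodic S := by
  obtain ⟨C, hC⟩ := hbdd
  let tM : TopologicalSpace (Set.range S) := @instTopologicalSpaceSubtype _ _ (sot X)
  obtain ⟨m, hm1, hm, hr, hl⟩ := hamen
  have hcont : ∀ y : X, @Continuous _ _ tM _ fun T : Set.range S => T.1 y := by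
    intro y
    have h1 : @Continuous _ _ (sot X) _ (fun T : X →L[ℂ] X => (T : X → X)) :=
      continuous_induced_dom
    have h2 : @Continuous (Set.range S) _ tM (sot X) Subtype.val :=
      @continuous_subtype_val _ (sot X) _
    exact (continuous_apply y).comp (@Continuous.comp _ _ _ tM (sot X) _ _ _ h1 h2)
  obtain ⟨P, hPmem, hP⟩ := aux_main (tM := tM) (Set.range S) hcont C
    (by rintro _ ⟨g, rfl⟩; exact hC g) m hm1 hm hcpt
  have hF : ∀ (y : X) (φ : X →L[ℂ] ℂ), ∃ f : @BoundedContinuousFunction (Set.range S) ℂ tM _,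
      ∀ T : Set.range S, f T = φ (T.1 y) := fun y φ =>
    ⟨BoundedContinuousFunction.ofNormedAddCommGroup (fun T : Set.range S => φ (T.1 y))
      (φ.continuous.comp (hcont y)) (‖φ‖ * (C * ‖y‖)) (fun T => by
        obtain ⟨_, g, rfl⟩ := T
        refine (φ.le_opNorm _).trans (mul_le_mul_of_nonneg_left ?_ (norm_nonneg _))
        exact ((S g).le_opNorm y).trans (mul_le_mul_of_nonneg_right (hC g) (norm_nonneg _))),
      fun _ => rfl⟩
  have hmul' : ∀ (g h : G) (y : X), S g (S h y) = S (h * g) y := fun g h y =>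
    congrArg (fun F : X →L[ℂ] X => F y) (hmul g h)
  refine ⟨P, hPmem, aux_sot_closed _ P ?_⟩
  rintro _ ⟨g, rfl⟩
  constructor
  · ext y
    refine (SeparatingDual.eq_iff_forall_dual_eq (R := ℂ)).2 fun φ => ?_
    obtain ⟨f, hf⟩ := hF y φ
    obtain ⟨f', hf'⟩ := hF (S g y) φ
    have h1 := hr g f f' (fun h => by rw [hf, hf', hmul'])
    rw [hP y φ f hf, hP (S g y) φ f' hf'] at h1
    exact h1
  · ext y
    refine (SeparatingDual.eq_iff_forall_dual_eq (R := ℂ)).2 fun φ => ?_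
    obtain ⟨f, hf⟩ := hF y φ
    obtain ⟨f', hf'⟩ := hF y (φ.comp (S g))
    have h1 := hl g f f' (fun h => by
      rw [hf, hf', ContinuousLinearMap.comp_apply, hmul'])
    rw [hP y φ f hf, hP y (φ.comp (S g)) f' hf'] at h1
    exact h1
end
end

section
/- Let K be a compact metric space, φ : K → K a continuous map admitting a unique φ-invariant Borel probability measure μ, and S : f ↦ f ∘ φ the Koopman operator on C(K). Let f ∈ C(K) be such that for every λ in the unit circle 𝕋 the averages (1/N) ∑_{n=0}^{N−1} λ^n f∘φ^n converge to 0 in L²(K,μ) (equivalently, P_λ f = 0 for the mean ergodic projection P_λ of {(λS)^n : n ∈ ℕ} on L²(K,μ)). Then for every Følner sequence (F_N)_{N∈ℕ} in ℕ, lim_{N→∞} sup_{λ∈𝕋} ‖(1/|F_N|) ∑_{n∈F_N} λ^n f∘φ^n‖_∞ = 0. -/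
open Filter Topology MeasureTheory

noncomputable section

lemma ww_shift {E : Type*} [NormedAddCommGroup E] (F : Finset ℕ) (g : ℕ → E) (C : ℝ)
    (hg : ∀ n, ‖g n‖ ≤ C) (k : ℕ) :
    ‖∑ n ∈ F, g (k + n) - ∑ n ∈ F, g n‖
      ≤ C * ((symmDiff (F.image fun n => k + n) F).card : ℝ) := by
  have h1 : ∑ n ∈ F, g (k + n) = ∑ n ∈ F.image (fun n => k + n), g n := by
    rw [Finset.sum_image]
    intro a _ b _ h
    simpa using h
  rw [h1, ← Finset.sum_sdiff_sub_sum_sdiff]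
  have hb : ∀ s : Finset ℕ, ‖∑ n ∈ s, g n‖ ≤ C * (s.card : ℝ) := by
    intro s
    have := norm_sum_le_of_le s (fun n _ => hg n)
    simpa [mul_comm] using this
  have hc : ((symmDiff (F.image fun n => k + n) F).card : ℝ)
      = ((F.image fun n => k + n) \ F).card + (F \ (F.image fun n => k + n)).card := by
    rw [symmDiff, Finset.sup_eq_union, Finset.card_union_of_disjoint disjoint_sdiff_sdiff]
    push_cast
    rfl
  rw [hc, mul_add]
  exact (norm_sub_le _ _).trans (add_le_add (hb _) (hb _))

lemma ww_key {K : Type} [MetricSpace K] [CompactSpace K] [MeasurableSpace K] [BorelSpace K]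
    (φ : K → K) (hφ : Continuous φ)
    (μ : Measure K)
    (huniq : ∀ ν : Measure K, IsProbabilityMeasure ν → Measure.map φ ν = ν → ν = μ)
    (F : ℕ → Finset ℕ)
    (hFne : ∀ N, (F N).Nonempty)
    (hFolner : ∀ k : ℕ,
      Tendsto (fun N : ℕ =>
          ((symmDiff ((F N).image fun n => k + n) (F N)).card : ℝ) / (F N).card)
        atTop (nhds 0))
    (U : Ultrafilter ℕ) (hU : (U : Filter ℕ) ≤ atTop) (x : ℕ → K) (h : K → ℝ)
    (hh : Continuous h) :
    Tendsto (fun N => ((F N).card : ℝ)⁻¹ * ∑ n ∈ F N, h (φ^[n] (x N))) U (𝓝 (∫ y, h y ∂μ)) := by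
  let m : ℕ → Measure K := fun N =>
    ((F N).card : ENNReal)⁻¹ • ∑ n ∈ F N, Measure.dirac (φ^[n] (x N))
  have hm : ∀ N, IsProbabilityMeasure (m N) := by
    intro N
    constructor
    have h0 : ((F N).card : ENNReal) ≠ 0 := by
      have := (hFne N).card_pos
      simp [this.ne', Finset.card_eq_zero, (hFne N).ne_empty]
    simp [m, ENNReal.inv_mul_cancel h0 (ENNReal.natCast_ne_top _)]
  have hint : ∀ N (g : K → ℝ), Continuous g →
      ∫ y, g y ∂(m N) = ((F N).card : ℝ)⁻¹ * ∑ n ∈ F N, g (φ^[n] (x N)) := by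
    intro N g hg
    simp only [m]
    rw [integral_smul_measure, integral_finset_sum_measure]
    · simp [integral_dirac]
    · intro i _
      exact integrable_dirac (by simp)
  let P : ℕ → ProbabilityMeasure K := fun N => ⟨m N, hm N⟩
  obtain ⟨ν, -, hν⟩ := (isCompact_univ (X := ProbabilityMeasure K)).ultrafilter_le_nhds
    (U.map P) (by simp)
  have hν' : Tendsto P U (𝓝 ν) := hν
  rw [ProbabilityMeasure.tendsto_iff_forall_integral_tendsto] at hν'
  have hlim : ∀ g : K → ℝ, Continuous g →
      Tendsto (fun N => ((F N).card : ℝ)⁻¹ * ∑ n ∈ F N, g (φ^[n] (x N))) U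
        (𝓝 (∫ y, g y ∂(ν : Measure K))) := by
    intro g hg
    have := hν' (BoundedContinuousFunction.mkOfCompact ⟨g, hg⟩)
    refine this.congr fun N => ?_
    exact hint N g hg
  have hνμ : (ν : Measure K) = μ := by
    apply huniq _ inferInstance
    have : IsProbabilityMeasure (Measure.map φ (ν : Measure K)) :=
      Measure.isProbabilityMeasure_map hφ.measurable.aemeasurable
    apply ext_of_forall_integral_eq_of_IsFiniteMeasure
    intro g
    rw [integral_map hφ.measurable.aemeasurable g.continuous.aestronglyMeasurable]
    have h1 := hlim (fun y => g (φ y)) (g.continuous.comp hφ)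
    have h2 := hlim g g.continuous
    have h3 : Tendsto (fun N => ((F N).card : ℝ)⁻¹ * ∑ n ∈ F N, g (φ (φ^[n] (x N)))
        - ((F N).card : ℝ)⁻¹ * ∑ n ∈ F N, g (φ^[n] (x N))) U (𝓝 0) := by
      have h4 : Tendsto (fun N : ℕ => ‖g‖ *
          (((symmDiff ((F N).image fun n => 1 + n) (F N)).card : ℝ) / (F N).card)) U (𝓝 0) := by
        simpa using ((hFolner 1).mono_left hU).const_mul ‖g‖
      refine squeeze_zero_norm (fun N => ?_) h4
      have := ww_shift (F N) (fun n => g (φ^[n] (x N))) ‖g‖ (fun n => g.norm_coe_le_norm _) 1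
      rw [← mul_sub, norm_mul, norm_inv, Real.norm_natCast, mul_div_assoc', div_eq_inv_mul]
      refine mul_le_mul_of_nonneg_left ?_ (by positivity)
      simpa [add_comm 1, Function.iterate_succ_apply'] using this
    exact sub_eq_zero.1 (tendsto_nhds_unique (h1.sub h2) h3)
  rw [← hνμ]
  exact hlim h hh

lemma ww_ineq {K : Type} (φ : K → K) (f : K → ℂ) (C : ℝ) (hC : ∀ x, ‖f x‖ ≤ C)
    (F : Finset ℕ) (hF : F.Nonempty) (M : ℕ) (hM : 0 < M) (l l0 : ℂ) (hl : ‖l‖ = 1) (x : K) :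
    ‖(F.card : ℂ)⁻¹ * ∑ n ∈ F, l ^ n * f (φ^[n] x)‖ ≤
      (F.card : ℝ)⁻¹ * ∑ n ∈ F, ‖(M : ℂ)⁻¹ • ∑ m ∈ Finset.range M, l0 ^ m * f (φ^[m] (φ^[n] x))‖
      + (M : ℝ)⁻¹ * ∑ m ∈ Finset.range M, ‖l ^ m - l0 ^ m‖ * C
      + (M : ℝ)⁻¹ * ∑ m ∈ Finset.range M,
          C * (((symmDiff (F.image fun n => m + n) F).card : ℝ) / F.card) := by
  set a : ℕ → ℂ := fun n => l ^ n * f (φ^[n] x) with ha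
  have hcard : (0 : ℝ) < F.card := by exact_mod_cast hF.card_pos
  have hM' : (0 : ℝ) < M := by exact_mod_cast hM
  have hMC : (M : ℂ) ≠ 0 := by exact_mod_cast hM.ne'
  have haC : ∀ n, ‖a n‖ ≤ C := by
    intro n
    simp only [ha, norm_mul, norm_pow, hl, one_pow, one_mul]
    exact hC _
  -- the averaged sum
  set B : ℂ := ∑ n ∈ F, (M : ℂ)⁻¹ * ∑ m ∈ Finset.range M, a (m + n) with hB
  have e1 : ‖∑ n ∈ F, a n - B‖ ≤ (M : ℝ)⁻¹ * ∑ m ∈ Finset.range M,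
      C * ((symmDiff (F.image fun n => m + n) F).card : ℝ) := by
    have : ∑ n ∈ F, a n - B = -((M : ℂ)⁻¹ * ∑ m ∈ Finset.range M,
        (∑ n ∈ F, a (m + n) - ∑ n ∈ F, a n)) := by
      rw [hB, ← Finset.mul_sum, Finset.sum_comm, Finset.sum_sub_distrib, Finset.sum_const,
        Finset.card_range, nsmul_eq_mul, mul_sub, inv_mul_cancel_left₀ hMC]
      ring
    rw [this, norm_neg, norm_mul, norm_inv, Complex.norm_natCast]
    refine mul_le_mul_of_nonneg_left ?_ (by positivity)
    exact norm_sum_le_of_le _ fun m _ => ww_shift F a C haC m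
  have e2 : ∀ n, ‖(M : ℂ)⁻¹ * ∑ m ∈ Finset.range M, a (m + n)‖ ≤
      ‖(M : ℂ)⁻¹ • ∑ m ∈ Finset.range M, l0 ^ m * f (φ^[m] (φ^[n] x))‖
      + (M : ℝ)⁻¹ * ∑ m ∈ Finset.range M, ‖l ^ m - l0 ^ m‖ * C := by
    intro n
    have h1 : (M : ℂ)⁻¹ * ∑ m ∈ Finset.range M, a (m + n)
        = l ^ n * ((M : ℂ)⁻¹ • ∑ m ∈ Finset.range M, l0 ^ m * f (φ^[m] (φ^[n] x))
          + (M : ℂ)⁻¹ * ∑ m ∈ Finset.range M, (l ^ m - l0 ^ m) * f (φ^[m] (φ^[n] x))) := by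
      rw [smul_eq_mul, ← mul_add, ← Finset.sum_add_distrib, mul_left_comm, Finset.mul_sum (a := l ^ n)]
      congr 1
      refine Finset.sum_congr rfl fun m _ => ?_
      simp only [ha, Function.iterate_add_apply]
      ring
    rw [h1, norm_mul, norm_pow, hl, one_pow, one_mul]
    refine (norm_add_le _ _).trans (add_le_add le_rfl ?_)
    rw [norm_mul, norm_inv, Complex.norm_natCast]
    refine mul_le_mul_of_nonneg_left ?_ (by positivity)
    refine norm_sum_le_of_le _ fun m _ => ?_
    rw [norm_mul]
    exact mul_le_mul_of_nonneg_left (hC _) (norm_nonneg _)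
  have e3 : ‖B‖ ≤ ∑ n ∈ F, ‖(M : ℂ)⁻¹ • ∑ m ∈ Finset.range M, l0 ^ m * f (φ^[m] (φ^[n] x))‖
      + F.card * ((M : ℝ)⁻¹ * ∑ m ∈ Finset.range M, ‖l ^ m - l0 ^ m‖ * C) := by
    refine (norm_sum_le_of_le _ fun n _ => e2 n).trans ?_
    rw [Finset.sum_add_distrib, Finset.sum_const, nsmul_eq_mul]
  have e4 : ‖∑ n ∈ F, a n‖ ≤ ‖B‖ + ‖∑ n ∈ F, a n - B‖ := by
    have := norm_add_le B (∑ n ∈ F, a n - B)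
    simpa using this
  rw [norm_mul, norm_inv, Complex.norm_natCast]
  have e5 := e4.trans (add_le_add e3 e1)
  have e6 := mul_le_mul_of_nonneg_left e5 (inv_nonneg.2 hcard.le)
  refine e6.trans (le_of_eq ?_)
  rw [mul_add, mul_add, inv_mul_cancel_left₀ hcard.ne']
  congr 1
  rw [mul_left_comm, Finset.mul_sum (a := (F.card : ℝ)⁻¹)]
  congr 1
  refine Finset.sum_congr rfl fun m _ => ?_
  ring

/-- Corollary 2.6 (1). Let `K` be compact metric, `φ : K → K`
continuous and uniquely ergodic with invariant measure `μ`, `S` the Koopman operator on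
`C(K)`.  If `f ∈ C(K)` satisfies `P_λ f = 0` for every `λ ∈ 𝕋` (the Cesàro averages
`(1/N) ∑_{n<N} λ^n f ∘ φ^n` tend to `0` in `L²(K,μ)`), then for every Følner sequence
`(F_N)` in `ℕ` one has `lim_N sup_{λ ∈ 𝕋} ‖(1/|F_N|) ∑_{n ∈ F_N} λ^n S^n f‖_∞ = 0`. -/
theorem wienerWintner_folner
    {K : Type} [MetricSpace K] [CompactSpace K] [MeasurableSpace K] [BorelSpace K]
    (φ : K → K) (hφ : Continuous φ)
    (μ : Measure K) [IsProbabilityMeasure μ]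
    (hinv : Measure.map φ μ = μ)
    (huniq : ∀ ν : Measure K, IsProbabilityMeasure ν → Measure.map φ ν = ν → ν = μ)
    (f : C(K, ℂ))
    (hf : ∀ l : ℂ, ‖l‖ = 1 →
      Tendsto (fun N : ℕ =>
          ∫ x : K, ‖(N : ℂ)⁻¹ • ∑ n ∈ Finset.range N, l ^ n * f (φ^[n] x)‖ ^ 2 ∂μ)
        atTop (nhds 0))
    (F : ℕ → Finset ℕ)
    (hFne : ∀ N, (F N).Nonempty)
    (hFolner : ∀ k : ℕ,
      Tendsto (fun N : ℕ =>
          ((symmDiff ((F N).image fun n => k + n) (F N)).card : ℝ) / (F N).card)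
        atTop (nhds 0)) :
    Tendsto (fun N : ℕ => ⨆ l : {l : ℂ // ‖l‖ = 1},
        ‖ContinuousMap.mk
            (fun x : K => (((F N).card : ℂ))⁻¹ * ∑ n ∈ F N, (l : ℂ) ^ n * f (φ^[n] x))
            (continuous_const.mul (continuous_finset_sum _ fun n _ =>
              continuous_const.mul (f.continuous.comp (hφ.iterate n))))‖)
      atTop (nhds 0) := by
  have hKne : Nonempty K := by
    by_contra hne
    rw [not_nonempty_iff] at hne
    have : μ Set.univ = 1 := measure_univ
    simp [Set.eq_empty_of_isEmpty] at this
  suffices hmain : ∀ ε : ℝ, 0 < ε → ∀ᶠ N in atTop, ∀ (l : ℂ) (x : K), ‖l‖ = 1 →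
      ‖(((F N).card : ℂ))⁻¹ * ∑ n ∈ F N, l ^ n * f (φ^[n] x)‖ ≤ ε by
    rw [Metric.tendsto_nhds]
    intro ε hε
    filter_upwards [hmain (ε / 2) (by positivity)] with N hN
    rw [Real.dist_eq, sub_zero, abs_of_nonneg (Real.iSup_nonneg fun _ => norm_nonneg _)]
    refine lt_of_le_of_lt (Real.iSup_le (fun l => ?_) (by positivity)) (half_lt_self hε)
    rw [ContinuousMap.norm_le _ (by positivity)]
    intro x
    exact hN l x l.2
  intro ε hε
  by_contra hcon
  set Bad : Set ℕ := {N | ¬ ∀ (l : ℂ) (x : K), ‖l‖ = 1 →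
      ‖(((F N).card : ℂ))⁻¹ * ∑ n ∈ F N, l ^ n * f (φ^[n] x)‖ ≤ ε} with hBad
  have hfreq : ∃ᶠ N in atTop, N ∈ Bad := by
    rw [Filter.not_eventually] at hcon
    exact hcon.mono fun N hN => by simpa only [hBad, Set.mem_ofPred_eq] using hN
  have hne : NeBot (atTop ⊓ 𝓟 Bad) := frequently_mem_iff_neBot.1 hfreq
  let U : Ultrafilter ℕ := Ultrafilter.of (atTop ⊓ 𝓟 Bad)
  have hU : (U : Filter ℕ) ≤ atTop := (Ultrafilter.of_le _).trans inf_le_left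
  have hUB : ∀ᶠ N in (U : Filter ℕ), N ∈ Bad :=
    ((Ultrafilter.of_le _).trans inf_le_right) (mem_principal_self Bad)
  have hch : ∀ N, ∃ p : ℂ × K, ‖p.1‖ = 1 ∧ (N ∈ Bad →
      ε < ‖(((F N).card : ℂ))⁻¹ * ∑ n ∈ F N, p.1 ^ n * f (φ^[n] p.2)‖) := by
    intro N
    by_cases hN : N ∈ Bad
    · have hN' := hN
      simp only [hBad, Set.mem_setOf_eq] at hN'
      push Not at hN'
      obtain ⟨l, x, hl, hx⟩ := hN'
      exact ⟨(l, x), hl, fun _ => hx⟩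
    · exact ⟨(1, hKne.some), by simp, fun h => absurd h hN⟩
  choose p hp1 hp2 using hch
  obtain ⟨l0, hl0, hlim⟩ := (isCompact_sphere (0 : ℂ) 1).ultrafilter_le_nhds
    (U.map fun N => (p N).1) (by
      rw [le_principal_iff]
      exact Filter.mem_map.2 (Filter.univ_mem' fun N => by simp [hp1 N]))
  have hlim' : Tendsto (fun N => (p N).1) U (𝓝 l0) := hlim
  have hl0' : ‖l0‖ = 1 := by simpa using hl0
  -- choose M
  obtain ⟨M, hM, hMpos⟩ := (((hf l0 hl0').eventually
    (gt_mem_nhds (show (0 : ℝ) < ε ^ 2 / 16 by positivity))).and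
      (eventually_gt_atTop 0)).exists
  set h : K → ℝ := fun y => ‖(M : ℂ)⁻¹ • ∑ n ∈ Finset.range M, l0 ^ n * f (φ^[n] y)‖ with hh
  have hcont : Continuous h := by
    have h1 : ∀ n : ℕ, Continuous fun y => f (φ^[n] y) := fun n =>
      f.continuous.comp (hφ.iterate n)
    simp only [hh, smul_eq_mul]
    fun_prop
  have hkey := ww_key φ hφ μ huniq F hFne hFolner U hU (fun N => (p N).2) (fun y => h y ^ 2)
    (hcont.pow 2)
  have hd : Tendsto (fun N => (M : ℝ)⁻¹ * ∑ m ∈ Finset.range M, ‖(p N).1 ^ m - l0 ^ m‖ * ‖f‖)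
      U (𝓝 0) := by
    have : Tendsto (fun l : ℂ => (M : ℝ)⁻¹ * ∑ m ∈ Finset.range M, ‖l ^ m - l0 ^ m‖ * ‖f‖)
        (𝓝 l0) (𝓝 ((M : ℝ)⁻¹ * ∑ m ∈ Finset.range M, ‖l0 ^ m - l0 ^ m‖ * ‖f‖)) := by
      apply Continuous.tendsto
      fun_prop
    simp only [sub_self, norm_zero, zero_mul, Finset.sum_const_zero, mul_zero] at this
    exact this.comp hlim'
  have he : Tendsto (fun N => (M : ℝ)⁻¹ * ∑ m ∈ Finset.range M,
          ‖f‖ * (((symmDiff ((F N).image fun n => m + n) (F N)).card : ℝ) / (F N).card))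
      U (𝓝 0) := by
    have : Tendsto (fun N => (M : ℝ)⁻¹ * ∑ m ∈ Finset.range M,
          ‖f‖ * (((symmDiff ((F N).image fun n => m + n) (F N)).card : ℝ) / (F N).card))
      U (𝓝 ((M : ℝ)⁻¹ * ∑ m ∈ Finset.range M, ‖f‖ * 0)) :=
      (tendsto_finset_sum _ fun m _ => ((hFolner m).mono_left hU).const_mul _).const_mul _
    simpa using this
  have hbound : ∀ᶠ N in (U : Filter ℕ), ε ≤ ε / 4
      + (4 / ε) * (((F N).card : ℝ)⁻¹ * ∑ n ∈ F N, h (φ^[n] (p N).2) ^ 2)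
      + (M : ℝ)⁻¹ * ∑ m ∈ Finset.range M, ‖(p N).1 ^ m - l0 ^ m‖ * ‖f‖
      + (M : ℝ)⁻¹ * ∑ m ∈ Finset.range M,
          ‖f‖ * (((symmDiff ((F N).image fun n => m + n) (F N)).card : ℝ) / (F N).card) := by
    filter_upwards [hUB] with N hN
    have h1 := hp2 N hN
    have h2 := ww_ineq φ f ‖f‖ (fun x => f.norm_coe_le_norm x) (F N) (hFne N) M hMpos
      (p N).1 l0 (hp1 N) (p N).2
    have hcard : (0 : ℝ) < (F N).card := by exact_mod_cast (hFne N).card_pos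
    have h3 : ((F N).card : ℝ)⁻¹ * ∑ n ∈ F N, h (φ^[n] (p N).2) ≤
        ε / 4 + (4 / ε) * (((F N).card : ℝ)⁻¹ * ∑ n ∈ F N, h (φ^[n] (p N).2) ^ 2) := by
      have h4 : ∀ n ∈ F N, h (φ^[n] (p N).2) ≤ ε / 4 + (4 / ε) * h (φ^[n] (p N).2) ^ 2 := by
        intro n _
        generalize h (φ^[n] (p N).2) = t
        have : ε / 4 + (4 / ε) * t ^ 2 - t = (4 / ε) * ((t - ε / 8) ^ 2 + 3 * ε ^ 2 / 64) := by
          field_simp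
          ring
        have h5 : 0 ≤ (4 / ε) * ((t - ε / 8) ^ 2 + 3 * ε ^ 2 / 64) := by positivity
        linarith
      have h6 := mul_le_mul_of_nonneg_left (Finset.sum_le_sum h4) (inv_nonneg.2 hcard.le)
      refine h6.trans (le_of_eq ?_)
      rw [Finset.sum_add_distrib, Finset.sum_const, nsmul_eq_mul, mul_add,
        inv_mul_cancel_left₀ hcard.ne', ← Finset.mul_sum, mul_left_comm]
    simp only [hh] at h3 ⊢
    linarith
  have hlimit := ge_of_tendsto (((tendsto_const_nhds (x := ε / 4)).add
    (hkey.const_mul (4 / ε))).add hd |>.add he) hbound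
  have hfin : (4 / ε) * ∫ y, h y ^ 2 ∂μ ≤ ε / 4 := by
    have := mul_le_mul_of_nonneg_left hM.le (show 0 ≤ 4 / ε by positivity)
    refine this.trans (le_of_eq ?_)
    field_simp
    norm_num
  linarith
end
end

section
/- Let K be a compact metric space, φ : K → K a continuous map admitting a unique φ-invariant Borel probability measure μ, and S : f ↦ f ∘ φ the Koopman operator on C(K). Let f ∈ C(K) be such that for every λ in the unit circle 𝕋 the averages (1/N) ∑_{n=0}^{N−1} λ^n f∘φ^n converge to 0 in L²(K,μ) (equivalently, P_λ f = 0 for the mean ergodic projection P_λ of {(λS)^n : n ∈ ℕ} on L²(K,μ)). Then lim_{r↑1} sup_{λ∈𝕋} ‖(1−r) ∑_{n=0}^{∞} r^n λ^n f∘φ^n‖_∞ = 0. -/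
open Filter Topology MeasureTheory

noncomputable section

/-- The Abel measure of the orbit of `x`. -/
def abelMeasure {K : Type} [MeasurableSpace K] (φ : K → K) (r : ℝ) (x : K) : Measure K :=
  Measure.sum (fun n : ℕ => ENNReal.ofReal ((1 - r) * r ^ n) • Measure.dirac (φ^[n] x))

theorem abelMeasure_prob {K : Type} [MeasurableSpace K] (φ : K → K) {r : ℝ} (h0 : 0 < r)
    (h1 : r < 1) (x : K) : IsProbabilityMeasure (abelMeasure φ r x) := by
  constructor
  rw [abelMeasure, Measure.sum_apply _ MeasurableSet.univ]
  simp only [Measure.smul_apply, measure_univ, smul_eq_mul, mul_one]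
  have hs : HasSum (fun n : ℕ => (1 - r) * r ^ n) 1 := by
    have := (hasSum_geometric_of_lt_one h0.le h1).mul_left (1 - r)
    rwa [mul_inv_cancel₀ (by linarith)] at this
  rw [← ENNReal.ofReal_tsum_of_nonneg _ hs.summable, hs.tsum_eq, ENNReal.ofReal_one]
  intro n
  have : 0 < 1 - r := by linarith
  positivity

theorem abelMeasure_hasSum {K : Type} [MetricSpace K] [CompactSpace K] [MeasurableSpace K]
    [BorelSpace K] (φ : K → K) {r : ℝ} (h0 : 0 < r) (h1 : r < 1) (x : K)
    (g : K → ℝ) (hg : Continuous g) :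
    HasSum (fun n : ℕ => (1 - r) * r ^ n * g (φ^[n] x)) (∫ y, g y ∂(abelMeasure φ r x)) := by
  have := abelMeasure_prob φ h0 h1 x
  have hi : Integrable g (abelMeasure φ r x) :=
    hg.integrable_of_hasCompactSupport (HasCompactSupport.of_compactSpace g)
  have h := hasSum_integral_measure hi
  refine h.congr_fun ?_ |> fun h => h
  intro n
  have : 0 ≤ (1 - r) * r ^ n := by
    have : 0 < 1 - r := by linarith
    positivity
  simp [integral_smul_measure, integral_dirac, ENNReal.toReal_ofReal this]

theorem abelMeasure_shift {K : Type} [MetricSpace K] [CompactSpace K] [MeasurableSpace K]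
    [BorelSpace K] (φ : K → K) (hφ : Continuous φ) {r : ℝ} (h0 : 0 < r) (h1 : r < 1) (x : K)
    (g : K → ℝ) (hg : Continuous g) :
    ∫ y, g y ∂(abelMeasure φ r x) = (1 - r) * g x + r * ∫ y, g (φ y) ∂(abelMeasure φ r x) := by
  have a := abelMeasure_hasSum φ h0 h1 x g hg
  have b := (abelMeasure_hasSum φ h0 h1 x (fun y => g (φ y)) (hg.comp hφ)).mul_left r
  rw [← a.tsum_eq, a.summable.tsum_eq_zero_add, ← b.tsum_eq]
  simp only [pow_zero, mul_one, Function.iterate_zero, id]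
  congr 1
  apply tsum_congr
  intro n
  rw [Function.iterate_succ_apply', pow_succ]
  ring

/-- Uniform convergence of Abel means under unique ergodicity. -/
theorem abel_unique_ergodic {K : Type} [MetricSpace K] [CompactSpace K] [MeasurableSpace K]
    [BorelSpace K] (φ : K → K) (hφ : Continuous φ)
    (μ : Measure K) [hμ : IsProbabilityMeasure μ]
    (huniq : ∀ ν : Measure K, IsProbabilityMeasure ν → Measure.map φ ν = ν → ν = μ)
    (g : K → ℝ) (hg : Continuous g) (ε : ℝ) (hε : 0 < ε) :
    ∀ᶠ r in 𝓝[Set.Ioo (0:ℝ) 1] 1, ∀ x, ∫ y, g y ∂(abelMeasure φ r x) < ∫ y, g y ∂μ + ε := by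
  classical
  let M : ℝ × K → ProbabilityMeasure K := fun p =>
    if h : 0 < p.1 ∧ p.1 < 1 then ⟨abelMeasure φ p.1 p.2, abelMeasure_prob φ h.1 h.2 p.2⟩
    else ⟨μ, hμ⟩
  have hM : ∀ r x, 0 < r → r < 1 → (M (r, x) : Measure K) = abelMeasure φ r x := by
    intro r x h0 h1
    simp [M, h0, h1]
  let L : Filter (ℝ × K) := 𝓝[Set.Ioo (0:ℝ) 1] 1 ×ˢ (⊤ : Filter K)
  have hLr : Tendsto Prod.fst L (𝓝[Set.Ioo (0:ℝ) 1] 1) := tendsto_fst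
  have hL1 : Tendsto Prod.fst L (𝓝 (1:ℝ)) := hLr.mono_right nhdsWithin_le_nhds
  have hLI : ∀ᶠ p in L, p.1 ∈ Set.Ioo (0:ℝ) 1 := hLr.eventually self_mem_nhdsWithin
  have key : Tendsto M L (𝓝 ⟨μ, hμ⟩) := by
    apply tendsto_nhds_of_unique_mapClusterPt
    intro ν hν
    rw [mapClusterPt_iff_ultrafilter] at hν
    obtain ⟨U, hU, hT⟩ := hν
    rw [ProbabilityMeasure.tendsto_iff_forall_integral_tendsto] at hT
    apply Subtype.ext
    refine huniq _ ν.2 ?_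
    have := ν.2
    have hpm : IsProbabilityMeasure (Measure.map φ (ν : Measure K)) :=
      Measure.isProbabilityMeasure_map hφ.aemeasurable
    apply ext_of_forall_integral_eq_of_IsFiniteMeasure
    intro h
    rw [integral_map hφ.aemeasurable h.continuous.aestronglyMeasurable]
    have t1 := hT h
    have t2 := hT (h.compContinuous ⟨φ, hφ⟩)
    have hr : Tendsto Prod.fst (U : Filter (ℝ × K)) (𝓝 (1:ℝ)) := hL1.mono_left hU
    have hz : Tendsto (fun p : ℝ × K => (1 - p.1) * h p.2) U (𝓝 0) := by
      have h1r : Tendsto (fun p : ℝ × K => 1 - p.1) U (𝓝 0) := by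
        simpa using hr.const_sub 1
      refine h1r.zero_mul_isBoundedUnder_le ?_
      refine isBoundedUnder_of ⟨‖h‖, fun p => h.norm_coe_le_norm p.2⟩
    have t3 := hz.add (hr.mul t2)
    rw [zero_add, one_mul] at t3
    refine (tendsto_nhds_unique (t1.congr' ?_) t3).symm
    filter_upwards [hU hLI] with p hp
    rw [show M p = M (p.1, p.2) from rfl, hM _ _ hp.1 hp.2]
    exact abelMeasure_shift φ hφ hp.1 hp.2 p.2 h h.continuous
  have key' := ProbabilityMeasure.tendsto_iff_forall_integral_tendsto.1 key
  have t := key' (BoundedContinuousFunction.mkOfCompact ⟨g, hg⟩)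
  have t' := t.eventually (gt_mem_nhds (show _ < ∫ y, g y ∂μ + ε from lt_add_of_pos_right _ hε))
  have t'' := t'.and hLI
  simp only [L, ← principal_univ] at t''
  rw [eventually_prod_principal_iff] at t''
  filter_upwards [t''] with r hr x
  obtain ⟨a, b⟩ := hr x (Set.mem_univ _)
  rw [hM _ _ b.1 b.2] at a
  exact a

/-- Pointwise Abel mean. -/
def ab {K : Type} (φ : K → K) (r : ℝ) (l : ℂ) (g : K → ℂ) (x : K) : ℂ :=
  (1 - r : ℂ) * ∑' n : ℕ, ((r : ℂ) ^ n * l ^ n) * g (φ^[n] x)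

section
variable {K : Type} (φ : K → K) {r : ℝ} (h0 : 0 < r) (h1 : r < 1) {l : ℂ} (hl : ‖l‖ = 1)

theorem norm_coef {r : ℝ} (h0 : 0 < r) {l : ℂ} (hl : ‖l‖ = 1) (n : ℕ) (z : ℂ) :
    ‖((r : ℂ) ^ n * l ^ n) * z‖ = r ^ n * ‖z‖ := by
  simp [hl, abs_of_pos h0]

theorem ab_summable {r : ℝ} (h0 : 0 < r) (h1 : r < 1) {l : ℂ} (hl : ‖l‖ = 1)
    (g : K → ℂ) (C : ℝ) (hC : ∀ x, ‖g x‖ ≤ C) (x : K) :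
    Summable (fun n : ℕ => ((r : ℂ) ^ n * l ^ n) * g (φ^[n] x)) := by
  refine Summable.of_norm_bounded (g := fun n => r ^ n * C)
    ((summable_geometric_of_lt_one h0.le h1).mul_right C) ?_
  intro n
  rw [norm_coef h0 hl]
  gcongr
  exact hC _

theorem norm_one_sub {r : ℝ} (h1 : r < 1) : ‖(1 - r : ℂ)‖ = 1 - r := by
  rw [← Complex.ofReal_one, ← Complex.ofReal_sub, Complex.norm_real, Real.norm_eq_abs,
    abs_of_pos (by linarith)]

theorem ab_bound_int [MetricSpace K] [CompactSpace K] [MeasurableSpace K]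
    [BorelSpace K] {r : ℝ} (h0 : 0 < r) (h1 : r < 1) {l : ℂ} (hl : ‖l‖ = 1)
    (g : K → ℂ) (u : K → ℝ) (hu : Continuous u) (hgu : ∀ x, ‖g x‖ ≤ u x) (x : K) :
    ‖ab φ r l g x‖ ≤ ∫ y, u y ∂(abelMeasure φ r x) := by
  have hs := abelMeasure_hasSum φ h0 h1 x u hu
  rw [ab, ← tsum_mul_left]
  refine tsum_of_norm_bounded hs ?_
  intro n
  rw [norm_mul, norm_coef h0 hl, norm_one_sub h1, ← mul_assoc]
  have : 0 < 1 - r := by linarith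
  gcongr
  exact hgu _

theorem ab_bound {r : ℝ} (h0 : 0 < r) (h1 : r < 1) {l : ℂ} (hl : ‖l‖ = 1)
    (g : K → ℂ) (C : ℝ) (hC : ∀ x, ‖g x‖ ≤ C) (x : K) :
    ‖ab φ r l g x‖ ≤ C := by
  have hs : HasSum (fun n : ℕ => (1 - r) * r ^ n * C) C := by
    have := ((hasSum_geometric_of_lt_one h0.le h1).mul_left (1 - r)).mul_right C
    rwa [mul_inv_cancel₀ (by linarith), one_mul] at this
  rw [ab, ← tsum_mul_left]
  refine tsum_of_norm_bounded hs ?_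
  intro n
  rw [norm_mul, norm_coef h0 hl, norm_one_sub h1, ← mul_assoc]
  have : 0 < 1 - r := by linarith
  gcongr
  exact hC _

theorem ab_shift {r : ℝ} (h0 : 0 < r) (h1 : r < 1) {l : ℂ} (hl : ‖l‖ = 1)
    (g : K → ℂ) (C : ℝ) (hC : ∀ x, ‖g x‖ ≤ C) (x : K) :
    ‖ab φ r l g x - l * ab φ r l (fun y => g (φ y)) x‖ ≤ (1 - r) * (2 * C) := by
  have e : ab φ r l g x = (1 - r) * g x + r * l * ab φ r l (fun y => g (φ y)) x := by
    have hs := ab_summable φ h0 h1 hl g C hC x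
    unfold ab
    rw [hs.tsum_eq_zero_add, mul_add, mul_left_comm (r * l : ℂ), ← tsum_mul_left (a := (r * l : ℂ))]
    simp only [pow_zero, one_mul, Function.iterate_zero, id]
    congr 2
    apply tsum_congr
    intro n
    rw [Function.iterate_succ_apply', pow_succ, pow_succ]
    ring
  have hb := ab_bound φ h0 h1 hl (fun y => g (φ y)) C (fun y => hC _) x
  have : ab φ r l g x - l * ab φ r l (fun y => g (φ y)) x
      = (1 - r) * (g x - l * ab φ r l (fun y => g (φ y)) x) := by
    rw [e]; ring
  rw [this, norm_mul, norm_one_sub h1]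
  have : 0 < 1 - r := by linarith
  gcongr
  refine (norm_sub_le _ _).trans ?_
  rw [norm_mul, hl, one_mul]
  linarith [hC x]

theorem ab_shift_iter {r : ℝ} (h0 : 0 < r) (h1 : r < 1) {l : ℂ} (hl : ‖l‖ = 1)
    (g : K → ℂ) (C : ℝ) (hC : ∀ x, ‖g x‖ ≤ C) (x : K) (n : ℕ) :
    ‖ab φ r l g x - l ^ n * ab φ r l (fun y => g (φ^[n] y)) x‖ ≤ n * ((1 - r) * (2 * C)) := by
  induction n with
  | zero => simp
  | succ n ih =>
    have h := ab_shift φ h0 h1 hl (fun y => g (φ^[n] y)) C (fun y => hC _) x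
    have e : ab φ r l g x - l ^ (n+1) * ab φ r l (fun y => g (φ^[n+1] y)) x
      = (ab φ r l g x - l ^ n * ab φ r l (fun y => g (φ^[n] y)) x) +
        l ^ n * (ab φ r l (fun y => g (φ^[n] y)) x
          - l * ab φ r l (fun y => g (φ^[n] (φ y))) x) := by
      simp only [Function.iterate_succ_apply]
      ring
    rw [e]
    refine (norm_add_le _ _).trans ?_
    rw [norm_mul, norm_pow, hl, one_pow, one_mul]
    push_cast
    linarith

/-- Cesàro average. -/
def ces (φ : K → K) (N : ℕ) (l : ℂ) (g : K → ℂ) (x : K) : ℂ :=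
  (N : ℂ)⁻¹ • ∑ n ∈ Finset.range N, l ^ n * g (φ^[n] x)

theorem ab_ces {r : ℝ} (h0 : 0 < r) (h1 : r < 1) {l : ℂ} (hl : ‖l‖ = 1)
    (g : K → ℂ) (C : ℝ) (hC : ∀ x, ‖g x‖ ≤ C) (x : K) (N : ℕ) :
    ab φ r l (ces φ N l g) x =
      (N : ℂ)⁻¹ * ∑ n ∈ Finset.range N, l ^ n * ab φ r l (fun y => g (φ^[n] y)) x := by
  unfold ab ces
  have : ∀ m, ((r : ℂ) ^ m * l ^ m) * ((N : ℂ)⁻¹ • ∑ n ∈ Finset.range N, l ^ n * g (φ^[n] (φ^[m] x)))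
      = (N : ℂ)⁻¹ * ∑ n ∈ Finset.range N, l ^ n * (((r : ℂ) ^ m * l ^ m) * g (φ^[n] (φ^[m] x))) := by
    intro m
    rw [smul_eq_mul, mul_left_comm, Finset.mul_sum]
    congr 1
    apply Finset.sum_congr rfl
    intros
    ring
  simp only [this]
  rw [tsum_mul_left, Summable.tsum_finsetSum, mul_left_comm, Finset.mul_sum]
  · congr 1
    apply Finset.sum_congr rfl
    intro n _
    rw [tsum_mul_left]
    ring
  · intro n _
    exact (ab_summable φ h0 h1 hl (fun y => g (φ^[n] y)) C (fun y => hC _) x).mul_left _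

theorem ab_sub_ces {r : ℝ} (h0 : 0 < r) (h1 : r < 1) {l : ℂ} (hl : ‖l‖ = 1)
    (g : K → ℂ) (C : ℝ) (hC : ∀ x, ‖g x‖ ≤ C) (x : K) (N : ℕ) (hN : 0 < N) :
    ‖ab φ r l g x‖ ≤ ‖ab φ r l (ces φ N l g) x‖ + N * ((1 - r) * (2 * C)) := by
  have hC0 : 0 ≤ C := (norm_nonneg _).trans (hC x)
  have hr : 0 < 1 - r := by linarith
  have hN' : (N : ℂ) ≠ 0 := by exact_mod_cast hN.ne'
  have e : ab φ r l g x = ab φ r l (ces φ N l g) x + (N : ℂ)⁻¹ * ∑ n ∈ Finset.range N,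
      (ab φ r l g x - l ^ n * ab φ r l (fun y => g (φ^[n] y)) x) := by
    rw [ab_ces φ h0 h1 hl g C hC, Finset.sum_sub_distrib, Finset.sum_const, Finset.card_range,
      nsmul_eq_mul, mul_sub, inv_mul_cancel_left₀ hN']
    ring
  conv_lhs => rw [e]
  refine (norm_add_le _ _).trans ?_
  gcongr
  rw [norm_mul, norm_inv, Complex.norm_natCast]
  have hNr : (0:ℝ) < N := by exact_mod_cast hN
  rw [inv_mul_le_iff₀ hNr]
  refine (norm_sum_le_of_le (f := _) (n := fun _ => (N : ℝ) * ((1 - r) * (2 * C))) _ ?_).trans ?_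
  · intro n hn
    refine (ab_shift_iter φ h0 h1 hl g C hC x n).trans ?_
    have : (n : ℝ) ≤ N := by exact_mod_cast (Finset.mem_range.1 hn).le
    gcongr
  · simp

end

theorem ces_cont {K : Type} [MetricSpace K] (φ : K → K) (hφ : Continuous φ) (N : ℕ)
    (g : K → ℂ) (hg : Continuous g) : Continuous (fun p : ℂ × K => ces φ N p.1 g p.2) := by
  unfold ces
  have h : Continuous (fun p : ℂ × K => ∑ n ∈ Finset.range N, p.1 ^ n * g (φ^[n] p.2)) := by
    refine continuous_finsetSum _ fun n _ => ?_
    exact (continuous_fst.pow n).mul (hg.comp ((hφ.iterate n).comp continuous_snd))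
  exact h.const_smul (N : ℂ)⁻¹

set_option maxHeartbeats 1000000 in
/-- Local estimate around one point of the circle. -/
theorem ab_local {K : Type} [MetricSpace K] [CompactSpace K] [MeasurableSpace K] [BorelSpace K]
    (φ : K → K) (hφ : Continuous φ)
    (μ : Measure K) [IsProbabilityMeasure μ]
    (huniq : ∀ ν : Measure K, IsProbabilityMeasure ν → Measure.map φ ν = ν → ν = μ)
    (f : C(K, ℂ)) (l0 : ℂ)
    (hf : Tendsto (fun N : ℕ => ∫ x : K, ‖ces φ N l0 f x‖ ^ 2 ∂μ) atTop (nhds 0))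
    (ε : ℝ) (hε : 0 < ε) :
    ∀ᶠ p : ℝ × ℂ in 𝓝 (1, l0), p.1 ∈ Set.Ioo (0:ℝ) 1 → ‖p.2‖ = 1 →
      ∀ x, ‖ab φ p.1 p.2 f x‖ ≤ 4 * ε := by
  obtain ⟨N, hNε, hN⟩ := ((hf.eventually (gt_mem_nhds (show 0 < ε ^ 2 by positivity))).and
    (eventually_gt_atTop 0)).exists
  have hc0 : Continuous (fun x => ces φ N l0 f x) :=
    (ces_cont φ hφ N f f.continuous).comp (Continuous.prodMk_right l0)
  have hL1bound : ∫ x, ‖ces φ N l0 f x‖ ∂μ ≤ ε := by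
    have hi : ∀ u : K → ℝ, Continuous u → Integrable u μ := fun u hu =>
      hu.integrable_of_hasCompactSupport (HasCompactSupport.of_compactSpace u)
    have h1 : ∫ x, ‖ces φ N l0 f x‖ ∂μ ≤ ∫ x, ((2 * ε)⁻¹ * ‖ces φ N l0 f x‖ ^ 2 + ε / 2) ∂μ := by
      refine integral_mono (hi _ hc0.norm) (hi _ (by fun_prop)) ?_
      intro x
      have : (2 * ε)⁻¹ * ‖ces φ N l0 f x‖ ^ 2 + ε / 2 - ‖ces φ N l0 f x‖
        = (2 * ε)⁻¹ * (‖ces φ N l0 f x‖ - ε) ^ 2 := by field_simp; ring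
      have h2 : 0 ≤ (2 * ε)⁻¹ * (‖ces φ N l0 f x‖ - ε) ^ 2 := by positivity
      show ‖ces φ N l0 f x‖ ≤ (2 * ε)⁻¹ * ‖ces φ N l0 f x‖ ^ 2 + ε / 2
      linarith
    rw [integral_add (hi _ (by fun_prop)) (hi _ (by fun_prop)), integral_const_mul] at h1
    have h3 : (2 * ε)⁻¹ * ∫ x, ‖ces φ N l0 f x‖ ^ 2 ∂μ ≤ (2 * ε)⁻¹ * ε ^ 2 := by gcongr
    have h4 : (2 * ε)⁻¹ * ε ^ 2 = ε / 2 := by field_simp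
    simp at h1
    simp at h3 h4
    linarith
  have hnear : ∀ᶠ l in 𝓝 l0, ∀ x ∈ (Set.univ : Set K), dist (ces φ N l f x) (ces φ N l0 f x) < ε := by
    apply isCompact_univ.eventually_forall_of_forall_eventually
    intro y _
    have hc := ces_cont φ hφ N f f.continuous
    have hcc : Continuous (fun z : ℂ × K => dist (ces φ N z.1 f z.2) (ces φ N l0 f z.2)) :=
      hc.dist (hc0.comp continuous_snd)
    exact hcc.continuousAt.eventually (gt_mem_nhds (by simpa using hε))
  have hue := abel_unique_ergodic φ hφ μ huniq (fun x => ‖ces φ N l0 f x‖ + ε)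
    (hc0.norm.add continuous_const) ε hε
  have hsm : ∀ᶠ r in 𝓝 (1:ℝ), N * ((1 - r) * (2 * ‖f‖)) < ε := by
    have : Continuous (fun r : ℝ => N * ((1 - r) * (2 * ‖f‖))) := by fun_prop
    exact this.continuousAt.eventually (gt_mem_nhds (by simpa using hε))
  rw [eventually_nhdsWithin_iff] at hue
  rw [nhds_prod_eq]
  filter_upwards [(hue.and hsm).prod_mk hnear] with p hp hr hl x
  obtain ⟨⟨a, b⟩, c⟩ := hp
  have h1 := ab_sub_ces φ hr.1 hr.2 hl f ‖f‖ f.norm_coe_le_norm x N hN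
  have h2 := ab_bound_int φ hr.1 hr.2 hl (ces φ N p.2 f) (fun x => ‖ces φ N l0 f x‖ + ε)
    (hc0.norm.add continuous_const) (fun y => by
      have := c y (Set.mem_univ _)
      rw [dist_eq_norm] at this
      have h := norm_le_insert' (ces φ N p.2 f y) (ces φ N l0 f y)
      linarith) x
  have h3 := a hr x
  rw [integral_add (μ := μ) (hc0.norm.integrable_of_hasCompactSupport (HasCompactSupport.of_compactSpace _))
    (integrable_const _)] at h3
  simp at h3
  linarith

/-- Corollary 2.6 (2). Let `K` be compact metric, `φ : K → K`
continuous and uniquely ergodic with invariant measure `μ`, `S` the Koopman operator on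
`C(K)`.  If `f ∈ C(K)` satisfies `P_λ f = 0` for every `λ ∈ 𝕋` (the Cesàro averages
`(1/N) ∑_{n<N} λ^n f ∘ φ^n` tend to `0` in `L²(K,μ)`), then
`lim_{r↑1} sup_{λ ∈ 𝕋} ‖(1-r) ∑_{n=0}^∞ r^n λ^n S^n f‖_∞ = 0`. -/
theorem wienerWintner_abel
    {K : Type} [MetricSpace K] [CompactSpace K] [MeasurableSpace K] [BorelSpace K]
    (φ : K → K) (hφ : Continuous φ)
    (μ : Measure K) [IsProbabilityMeasure μ]
    (hinv : Measure.map φ μ = μ)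
    (huniq : ∀ ν : Measure K, IsProbabilityMeasure ν → Measure.map φ ν = ν → ν = μ)
    (f : C(K, ℂ))
    (hf : ∀ l : ℂ, ‖l‖ = 1 →
      Tendsto (fun N : ℕ =>
          ∫ x : K, ‖(N : ℂ)⁻¹ • ∑ n ∈ Finset.range N, l ^ n * f (φ^[n] x)‖ ^ 2 ∂μ)
        atTop (nhds 0)) :
    Tendsto (fun r : ℝ => ⨆ l : {l : ℂ // ‖l‖ = 1},
        ‖(1 - r) • ∑' n : ℕ, (((r : ℂ)) ^ n * (l : ℂ) ^ n) •
            ContinuousMap.mk (fun x : K => f (φ^[n] x))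
              (f.continuous.comp (hφ.iterate n))‖)
      (nhdsWithin 1 (Set.Ioo (0 : ℝ) 1)) (nhds 0) := by

  rw [Metric.tendsto_nhds]
  intro ε hε
  have hev : ∀ᶠ r in 𝓝 (1:ℝ), ∀ l ∈ Metric.sphere (0:ℂ) 1, r ∈ Set.Ioo (0:ℝ) 1 → ‖l‖ = 1 →
      ∀ x, ‖ab φ r l f x‖ ≤ 4 * (ε / 8) := by
    apply (isCompact_sphere (0:ℂ) 1).eventually_forall_of_forall_eventually
    intro l hl
    exact ab_local φ hφ μ huniq f l (hf l (by simpa using hl)) (ε / 8) (by positivity)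
  rw [eventually_nhdsWithin_iff]
  filter_upwards [hev] with r hr hI
  rw [Real.dist_eq, sub_zero, abs_of_nonneg (Real.iSup_nonneg fun _ => norm_nonneg _)]
  refine lt_of_le_of_lt (Real.iSup_le (a := ε / 2) ?_ (by positivity)) (by linarith)
  rintro ⟨l, hl⟩
  rw [ContinuousMap.norm_le _ (by positivity)]
  intro x
  have h := hr l (by simpa using hl) hI hl x
  have hs : Summable (fun n : ℕ => (((r : ℂ)) ^ n * (l : ℂ) ^ n) •
            ContinuousMap.mk (fun x : K => f (φ^[n] x))
              (f.continuous.comp (hφ.iterate n))) := by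
    refine Summable.of_norm_bounded (g := fun n => r ^ n * ‖f‖)
      ((summable_geometric_of_lt_one hI.1.le hI.2).mul_right _) ?_
    intro n
    have h0 := hI.1.le
    rw [ContinuousMap.norm_le _ (by positivity)]
    intro y
    rw [ContinuousMap.smul_apply, smul_eq_mul, norm_coef hI.1 hl]
    gcongr
    exact f.norm_coe_le_norm _
  rw [ContinuousMap.smul_apply]
  simp only []
  rw [← ContinuousMap.tsum_apply hs]
  have e : (1 - r) • ∑' n : ℕ, ((((r : ℂ)) ^ n * (l : ℂ) ^ n) •
            ContinuousMap.mk (fun x : K => f (φ^[n] x))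
              (f.continuous.comp (hφ.iterate n))) x = ab φ r l f x := by
    unfold ab
    rw [Complex.real_smul]
    push_cast
    rfl
  rw [e]
  linarith
end
end
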